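/- arXiv:1908.11110 — 6 statements merged into one kernel-verified Lean document; each statement's English description precedes it below -/
import Mathlib

section
/- Let S = (P, L) be a finite partial linear space with collinearity relation R (the set of ordered pairs of distinct collinear points). Let G ≤ Aut(S) be transitive on P and transitive on R. Let L ∈ L, let u ∈ L, and set B := L \ {u}. Then: (i) B is a block for the action of G_u on S(u); (ii) the setwise stabilizer G_L induces a 2-transitive permutation group on L; (iii) if S is a proper partial linear space and G is primitive on P, then B is a non-trivial block of G_u on S(u), i.e. B is neither a singleton nor all of S(u). -/
open scoped Pointwise

/-- A partial linear space on the point set `P`: a set of lines (subsets of `P`) such that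
any two distinct points lie on at most one common line and every line has at least two
points. -/
structure PLS (P : Type*) where
  lines : Set (Set P)
  two_le_ncard : ∀ L ∈ lines, 2 ≤ L.ncard
  unique_of_pair : ∀ L₁ ∈ lines, ∀ L₂ ∈ lines, ∀ x y : P,
    x ≠ y → x ∈ L₁ → y ∈ L₁ → x ∈ L₂ → y ∈ L₂ → L₁ = L₂

namespace PLS

variable {P : Type*}

/-- Two points are collinear if they are distinct and lie on a common line. -/
def Collinear (S : PLS P) (x y : P) : Prop :=
  x ≠ y ∧ ∃ L ∈ S.lines, x ∈ L ∧ y ∈ L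

/-- The set of points collinear with `x`. -/
def nbrs (S : PLS P) (x : P) : Set P :=
  {y : P | S.Collinear x y}

/-- A linear space: any two distinct points lie on exactly one line. -/
def IsLinearSpace (S : PLS P) : Prop :=
  ∀ x y : P, x ≠ y → ∃! L, L ∈ S.lines ∧ x ∈ L ∧ y ∈ L

/-- A graph: every line has exactly two points. -/
def IsGraph (S : PLS P) : Prop :=
  ∀ L ∈ S.lines, L.ncard = 2

/-- Proper: neither a linear space nor a graph. -/
def IsProper (S : PLS P) : Prop :=
  ¬ S.IsLinearSpace ∧ ¬ S.IsGraph

/-- The automorphism group of `S`: all permutations of the point set mapping the line set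
onto itself. -/
def aut (S : PLS P) : Subgroup (Equiv.Perm P) :=
  MulAction.stabilizer (Equiv.Perm P) S.lines

end PLS

/-- `G` is a transitive permutation group. -/
def IsTransitivePerm {Ω : Type*} (G : Subgroup (Equiv.Perm Ω)) : Prop :=
  ∀ x y : Ω, ∃ g ∈ G, g x = y

/-- `G` is primitive: it is transitive and preserves no equivalence relation on the
underlying set other than equality and the universal relation. -/
def IsPrimitivePerm {Ω : Type*} (G : Subgroup (Equiv.Perm Ω)) : Prop :=
  IsTransitivePerm G ∧
    ∀ r : Ω → Ω → Prop, Equivalence r →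
      (∀ g ∈ G, ∀ x y : Ω, r x y → r (g x) (g y)) →
      (∀ x y : Ω, r x y ↔ x = y) ∨ (∀ x y : Ω, r x y)

namespace PLS

variable {P : Type*} {S : PLS P}

theorem image_mem_lines {g : Equiv.Perm P} (hg : g ∈ S.aut) {M : Set P} (hM : M ∈ S.lines) :
    g '' M ∈ S.lines := by
  have h : g • S.lines = S.lines := MulAction.mem_stabilizer_iff.mp hg
  rw [← h]
  exact Set.smul_mem_smul_set hM

theorem Collinear.symm {x y : P} (h : S.Collinear x y) : S.Collinear y x := by
  obtain ⟨hne, M, hM, hx, hy⟩ := h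
  exact ⟨hne.symm, M, hM, hy, hx⟩

theorem Collinear.map {g : Equiv.Perm P} (hg : g ∈ S.aut) {x y : P} (h : S.Collinear x y) :
    S.Collinear (g x) (g y) := by
  obtain ⟨hne, M, hM, hx, hy⟩ := h
  exact ⟨g.injective.ne hne, g '' M, image_mem_lines hg hM,
    Set.mem_image_of_mem g hx, Set.mem_image_of_mem g hy⟩

theorem collinear_of_map {g : Equiv.Perm P} (hg : g ∈ S.aut) {x y : P}
    (h : S.Collinear (g x) (g y)) : S.Collinear x y := by
  simpa using h.map (S.aut.inv_mem hg)

/-- An automorphism mapping two distinct points of `M` into `N` maps `M` onto `N`. -/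
theorem image_eq_of_pair {g : Equiv.Perm P} (hg : g ∈ S.aut) {M N : Set P} (hM : M ∈ S.lines)
    (hN : N ∈ S.lines) {x y : P} (hne : x ≠ y) (hx : x ∈ M) (hy : y ∈ M)
    (hgx : g x ∈ N) (hgy : g y ∈ N) : g '' M = N :=
  S.unique_of_pair _ (image_mem_lines hg hM) _ hN (g x) (g y) (g.injective.ne hne)
    (Set.mem_image_of_mem g hx) (Set.mem_image_of_mem g hy) hgx hgy

theorem exists_pair_of_mem_lines {M : Set P} (hM : M ∈ S.lines) :
    ∃ x ∈ M, ∃ y ∈ M, x ≠ y := by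
  have h : 1 < M.ncard := S.two_le_ncard M hM
  have hfin : M.Finite := Set.finite_of_ncard_pos (by omega)
  obtain ⟨x, y, hx, hy, hne⟩ := (Set.one_lt_ncard_iff hfin).mp h
  exact ⟨x, hx, y, hy, hne⟩

theorem ncard_eq_of_transitive_collinear {G : Subgroup (Equiv.Perm P)} (hG : G ≤ S.aut)
    (htransR : ∀ x y x' y' : P, S.Collinear x y → S.Collinear x' y' →
      ∃ g ∈ G, g x = x' ∧ g y = y')
    {M N : Set P} (hM : M ∈ S.lines) (hN : N ∈ S.lines) : M.ncard = N.ncard := by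
  obtain ⟨x, hx, y, hy, hxy⟩ := exists_pair_of_mem_lines hM
  obtain ⟨x', hx', y', hy', hxy'⟩ := exists_pair_of_mem_lines hN
  obtain ⟨g, hg, rfl, rfl⟩ := htransR x y x' y' ⟨hxy, M, hM, hx, hy⟩ ⟨hxy', N, hN, hx', hy'⟩
  rw [← image_eq_of_pair (hG hg) hM hN hxy hx hy hx' hy', Set.ncard_image_of_injective M g.injective]

/-- If all neighbours of some point lie on one line, then equality or collinearity is an
equivalence relation, provided a transitive group of automorphisms exists. -/
theorem equivalence_eq_or_collinear {G : Subgroup (Equiv.Perm P)} (hG : G ≤ S.aut)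
    (htrans : IsTransitivePerm G) {L : Set P} (hL : L ∈ S.lines) {u : P}
    (hu : S.nbrs u ⊆ L) : Equivalence fun x y => x = y ∨ S.Collinear x y where
  refl _ := Or.inl rfl
  symm h := h.imp Eq.symm Collinear.symm
  trans := by
    rintro x y z (rfl | hxy) (rfl | hyz)
    · exact Or.inl rfl
    · exact Or.inr hyz
    · exact Or.inr hxy
    · by_cases hxz : x = z
      · exact Or.inl hxz
      · obtain ⟨g, hg, rfl⟩ := htrans y u
        exact Or.inr (collinear_of_map (hG hg) ⟨g.injective.ne hxz, L, hL,
          hu (hxy.symm.map (hG hg)), hu (hyz.map (hG hg))⟩)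

theorem isLinearSpace_of_forall_collinear (h : ∀ x y : P, x ≠ y → S.Collinear x y) :
    S.IsLinearSpace := by
  intro x y hne
  obtain ⟨-, M, hM, hx, hy⟩ := h x y hne
  exact ⟨M, ⟨hM, hx, hy⟩, fun N ⟨hN, hx', hy'⟩ =>
    S.unique_of_pair N hN M hM x y hne hx' hy' hx hy⟩

end PLS

/-- **Lemma 2.6.** Let `S` be a finite partial linear space and `G ≤ Aut(S)` be transitive
on points and on ordered pairs of collinear points.  For a line `L`, a point `u ∈ L` and
`B := L \ {u}`: (i) `B` is a block of `G_u` on `S(u)`; (ii) the setwise stabiliser of `L`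
induces a 2-transitive group on `L`; (iii) if `S` is proper and `G` is primitive, then `B`
is a non-trivial block of `G_u` on `S(u)`. -/
theorem line_block_lemma
    {P : Type*} [Finite P] [Nonempty P] (S : PLS P)
    (G : Subgroup (Equiv.Perm P)) (hG : G ≤ S.aut)
    (htrans : IsTransitivePerm G)
    (htransR : ∀ x y x' y' : P, S.Collinear x y → S.Collinear x' y' →
      ∃ g ∈ G, g x = x' ∧ g y = y')
    (L : Set P) (hL : L ∈ S.lines) (u : P) (hu : u ∈ L)
    (B : Set P) (hB : B = L \ {u}) :
    (B.Nonempty ∧ B ⊆ S.nbrs u ∧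
      ∀ g ∈ G, g u = u → g '' B = B ∨ g '' B ∩ B = ∅) ∧
    (∀ x ∈ L, ∀ y ∈ L, ∀ x' ∈ L, ∀ y' ∈ L, x ≠ y → x' ≠ y' →
      ∃ g ∈ G, g '' L = L ∧ g x = x' ∧ g y = y') ∧
    (S.IsProper → IsPrimitivePerm G →
      (¬ ∃ v : P, B = {v}) ∧ B ≠ S.nbrs u) := by
  subst hB
  obtain ⟨v, hv, hvu⟩ : ∃ v ∈ L, v ≠ u := by
    obtain ⟨x, hx, y, hy, hxy⟩ := PLS.exists_pair_of_mem_lines hL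
    by_cases h : x = u
    · exact ⟨y, hy, fun h' => hxy (h.trans h'.symm)⟩
    · exact ⟨x, hx, h⟩
  refine ⟨⟨⟨v, hv, hvu⟩, fun x hx => ⟨fun h => hx.2 h.symm, L, hL, hu, hx.1⟩, ?_⟩, ?_, ?_⟩
  · intro g hg hgu
    refine or_iff_not_imp_right.mpr fun hne => ?_
    obtain ⟨_, ⟨x, hx, rfl⟩, hgx⟩ := Set.nonempty_iff_ne_empty.mpr hne
    rw [Set.image_sdiff g.injective, Set.image_singleton, hgu,
      PLS.image_eq_of_pair (hG hg) hL hL hx.2 hx.1 hu hgx.1 (hgu.symm ▸ hu)]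
  · intro x hx y hy x' hx' y' hy' hxy hxy'
    obtain ⟨g, hg, rfl, rfl⟩ :=
      htransR x y x' y' ⟨hxy, L, hL, hx, hy⟩ ⟨hxy', L, hL, hx', hy'⟩
    exact ⟨g, hg, PLS.image_eq_of_pair (hG hg) hL hL hxy hx hy hx' hy', rfl, rfl⟩
  · rintro ⟨hlin, hgraph⟩ ⟨-, hprim⟩
    constructor
    · rintro ⟨w, hw⟩
      refine hgraph fun M hM => ?_
      rw [PLS.ncard_eq_of_transitive_collinear hG htransR hM hL,
        ← Set.ncard_sdiff_singleton_add_one hu, hw, Set.ncard_singleton]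
    · intro hB
      have hnbrs : S.nbrs u ⊆ L := hB ▸ Set.sdiff_subset
      rcases hprim _ (PLS.equivalence_eq_or_collinear hG htrans hL hnbrs)
        (fun g hg x y h => h.imp (congrArg g) (PLS.Collinear.map (hG hg))) with h | h
      · exact hvu ((h v u).mp (Or.inr ⟨hvu, L, hL, hv, hu⟩))
      · exact hlin (PLS.isLinearSpace_of_forall_collinear
          fun x y hne => (h x y).resolve_left hne)
end

section
/- Let G be a transitive permutation group on a finite set P, let u ∈ P, let X be an orbit of G_u on P \ {u}, and let B be a block for the action of G_u on X. Set L := B ∪ {u}, let 𝓛 := {L^g : g ∈ G} be the G-orbit of L, and let S := (P, 𝓛). Suppose that the setwise stabilizer G_L is transitive on L. Then: (i) S is a partial linear space with G ≤ Aut(S) and S(u) = X; (ii) S is a linear space if and only if G is 2-transitive on P; (iii) if B is a non-trivial block (i.e. 1 < |B| < |X|), then every line of S contains at least 3 points and every point of S lies on at least 2 lines; (iv) if B is a non-trivial block and G has rank 3 on P, then S is a proper partial linear space. -/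
/-- The orbit of an ordered pair under the (diagonal) action of `G`. -/
def pairOrbit {Ω : Type*} (G : Subgroup (Equiv.Perm Ω)) (z : Ω × Ω) : Set (Ω × Ω) :=
  {w : Ω × Ω | ∃ g ∈ G, g z.1 = w.1 ∧ g z.2 = w.2}

/-- `G` is transitive of rank `3`: it is transitive and has exactly three orbits on
ordered pairs. -/
def IsRankThree {Ω : Type*} (G : Subgroup (Equiv.Perm Ω)) : Prop :=
  IsTransitivePerm G ∧
    ∃ a b c : Ω × Ω,
      pairOrbit G a ≠ pairOrbit G b ∧ pairOrbit G a ≠ pairOrbit G c ∧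
        pairOrbit G b ≠ pairOrbit G c ∧
        ∀ z : Ω × Ω, z ∈ pairOrbit G a ∪ pairOrbit G b ∪ pairOrbit G c

open Set

theorem mem_pairOrbit_self {Ω : Type*} (G : Subgroup (Equiv.Perm Ω)) (z : Ω × Ω) :
    z ∈ pairOrbit G z :=
  ⟨1, G.one_mem, rfl, rfl⟩

theorem pairOrbit_eq_of_mem {Ω : Type*} {G : Subgroup (Equiv.Perm Ω)} {z w : Ω × Ω}
    (h : w ∈ pairOrbit G z) : pairOrbit G w = pairOrbit G z := by
  obtain ⟨g, hg, h1, h2⟩ := h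
  ext t
  constructor
  · rintro ⟨k, hk, k1, k2⟩
    exact ⟨k * g, G.mul_mem hk hg, by simp [h1, k1], by simp [h2, k2]⟩
  · rintro ⟨k, hk, k1, k2⟩
    exact ⟨k * g⁻¹, G.mul_mem hk (G.inv_mem hg), by simp [← h1, k1], by simp [← h2, k2]⟩

theorem IsRankThree.not_two_transitive {Ω : Type*} {G : Subgroup (Equiv.Perm Ω)}
    (hG : IsRankThree G) :
    ¬ ∀ x y x' y' : Ω, x ≠ y → x' ≠ y' → ∃ g ∈ G, g x = x' ∧ g y = y' := by
  intro h2
  obtain ⟨ht, a, b, c, hab, hac, hbc, -⟩ := hG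
  have key : ∀ z w : Ω × Ω, (z.1 = z.2 ↔ w.1 = w.2) → pairOrbit G z = pairOrbit G w := by
    rintro ⟨x, y⟩ ⟨x', y'⟩ hzw
    refine (pairOrbit_eq_of_mem ?_).symm
    by_cases hxy : x = y
    · obtain ⟨g, hg, h⟩ := ht x x'
      exact ⟨g, hg, h, (congrArg g hxy).symm.trans (h.trans (hzw.1 hxy))⟩
    · exact h2 x y x' y' hxy fun h => hxy (hzw.2 h)
  have hab' := mt (key a b) hab
  have hac' := mt (key a c) hac
  have hbc' := mt (key b c) hbc
  tauto

/-- **Lemma 2.7.** Let `G` be a transitive permutation group on a finite set `P`, let `X`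
be an orbit of `G_u` on `P \ {u}`, let `B` be a block of `G_u` on `X`, let `L := B ∪ {u}`
and let `𝓛` be the `G`-orbit of `L`.  If the setwise stabiliser of `L` in `G` is
transitive on `L` then: (i) `(P, 𝓛)` is a partial linear space admitting `G` with
`S(u) = X`; (ii) it is a linear space iff `G` is 2-transitive; (iii) if `B` is a
non-trivial block then lines have at least 3 points and each point is on at least 2
lines; (iv) if moreover `G` has rank 3 then `(P, 𝓛)` is proper. -/
theorem construction_lemma
    {P : Type*} [Finite P] [Nonempty P]
    (G : Subgroup (Equiv.Perm P)) (htrans : IsTransitivePerm G)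
    (u x₀ : P) (hx₀ : x₀ ≠ u)
    (X : Set P) (hX : X = {v : P | ∃ g ∈ G, g u = u ∧ g x₀ = v})
    (B : Set P) (hBsub : B ⊆ X) (hBne : B.Nonempty)
    (hBblock : ∀ g ∈ G, g u = u → g '' B = B ∨ g '' B ∩ B = ∅)
    (L : Set P) (hLdef : L = B ∪ {u})
    (𝓛 : Set (Set P)) (h𝓛 : 𝓛 = {M : Set P | ∃ g ∈ G, M = g '' L})
    (hGL : ∀ x ∈ L, ∀ y ∈ L, ∃ g ∈ G, g '' L = L ∧ g x = y) :
    ((∀ M ∈ 𝓛, 2 ≤ M.ncard) ∧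
     (∀ M₁ ∈ 𝓛, ∀ M₂ ∈ 𝓛, ∀ x y : P,
        x ≠ y → x ∈ M₁ → y ∈ M₁ → x ∈ M₂ → y ∈ M₂ → M₁ = M₂) ∧
     (∀ g ∈ G, ∀ M : Set P, M ∈ 𝓛 ↔ g '' M ∈ 𝓛) ∧
     {v : P | v ≠ u ∧ ∃ M ∈ 𝓛, u ∈ M ∧ v ∈ M} = X) ∧
    ((∀ x y : P, x ≠ y → ∃! M, M ∈ 𝓛 ∧ x ∈ M ∧ y ∈ M) ↔
      (∀ x y x' y' : P, x ≠ y → x' ≠ y' → ∃ g ∈ G, g x = x' ∧ g y = y')) ∧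
    (1 < B.ncard → B.ncard < X.ncard →
      (∀ M ∈ 𝓛, 3 ≤ M.ncard) ∧ ∀ x : P, 2 ≤ {M : Set P | M ∈ 𝓛 ∧ x ∈ M}.ncard) ∧
    (1 < B.ncard → B.ncard < X.ncard → IsRankThree G →
      ¬ (∀ x y : P, x ≠ y → ∃! M, M ∈ 𝓛 ∧ x ∈ M ∧ y ∈ M) ∧
      ¬ (∀ M ∈ 𝓛, M.ncard = 2)) := by
  have huX : u ∉ X := by
    rw [hX]
    rintro ⟨g, -, hgu, hgx⟩
    exact hx₀ (g.injective (hgx.trans hgu.symm))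
  have huB : u ∉ B := fun h => huX (hBsub h)
  have huL : u ∈ L := by simp [hLdef]
  have hBL : B ⊆ L := by simp [hLdef]
  have mem_B : ∀ {v}, v ∈ L → v ≠ u → v ∈ B := by
    intro v hv hne
    simpa [hLdef, hne] using hv
  have hmem : ∀ {M}, M ∈ 𝓛 ↔ ∃ g ∈ G, M = g '' L := by simp [h𝓛]
  have based : ∀ {M x}, M ∈ 𝓛 → x ∈ M → ∃ g ∈ G, M = g '' L ∧ g u = x := by
    intro M x hM hx
    obtain ⟨g, hg, rfl⟩ := hmem.1 hM
    obtain ⟨l, hl, rfl⟩ := hx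
    obtain ⟨h, hh, hhL, hhu⟩ := hGL u huL l hl
    refine ⟨g * h, G.mul_mem hg hh, ?_, by simp [hhu]⟩
    rw [Equiv.Perm.coe_mul, image_comp, hhL]
  have hX_trans : ∀ {v w}, v ∈ X → w ∈ X → ∃ g ∈ G, g u = u ∧ g v = w := by
    rw [hX]
    rintro v w ⟨g, hg, hgu, rfl⟩ ⟨h, hh, hhu, rfl⟩
    have hgu' : g⁻¹ u = u := by rw [Equiv.Perm.inv_eq_iff_eq, hgu]
    exact ⟨h * g⁻¹, G.mul_mem hh (G.inv_mem hg), by rw [Equiv.Perm.mul_apply, hgu', hhu], by simp⟩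
  have hX_inv : ∀ {g v}, g ∈ G → g u = u → v ∈ X → g v ∈ X := by
    rw [hX]
    rintro g v hg hgu ⟨h, hh, hhu, rfl⟩
    exact ⟨g * h, G.mul_mem hg hh, by simp [hhu, hgu], by simp⟩
  have hL_card : L.ncard = B.ncard + 1 := by
    rw [hLdef, union_singleton, ncard_insert_of_notMem huB]
  have line_card : ∀ M ∈ 𝓛, M.ncard = B.ncard + 1 := by
    intro M hM
    obtain ⟨g, -, rfl⟩ := hmem.1 hM
    rw [ncard_image_of_injective _ g.injective, hL_card]
  have hL_mem : L ∈ 𝓛 := hmem.2 ⟨1, G.one_mem, by simp⟩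
  have image_mem : ∀ g ∈ G, ∀ M ∈ 𝓛, g '' M ∈ 𝓛 := by
    intro g hg M hM
    obtain ⟨h, hh, rfl⟩ := hmem.1 hM
    exact hmem.2 ⟨g * h, G.mul_mem hg hh, by rw [Equiv.Perm.coe_mul, image_comp]⟩
  have unique : ∀ M₁ ∈ 𝓛, ∀ M₂ ∈ 𝓛, ∀ x y : P,
      x ≠ y → x ∈ M₁ → y ∈ M₁ → x ∈ M₂ → y ∈ M₂ → M₁ = M₂ := by
    intro M₁ hM₁ M₂ hM₂ x y hxy hx₁ hy₁ hx₂ hy₂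
    obtain ⟨g, hg, rfl, hgu⟩ := based hM₁ hx₁
    obtain ⟨h, hh, rfl, hhu⟩ := based hM₂ hx₂
    obtain ⟨b, hb, hgb⟩ := hy₁
    obtain ⟨c, hc, hhc⟩ := hy₂
    have hbB : b ∈ B := mem_B hb (by rintro rfl; exact hxy (hgu.symm.trans hgb))
    have hcB : c ∈ B := mem_B hc (by rintro rfl; exact hxy (hhu.symm.trans hhc))
    have hku : (h⁻¹ * g) u = u := by
      rw [Equiv.Perm.mul_apply, Equiv.Perm.inv_eq_iff_eq, hgu, hhu]
    have hkb : (h⁻¹ * g) b = c := by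
      rw [Equiv.Perm.mul_apply, Equiv.Perm.inv_eq_iff_eq, hgb, hhc]
    have hkB : (h⁻¹ * g : Equiv.Perm P) '' B = B := by
      refine (hBblock _ (G.mul_mem (G.inv_mem hh) hg) hku).resolve_right fun h0 => ?_
      have : c ∈ (h⁻¹ * g : Equiv.Perm P) '' B ∩ B := ⟨⟨b, hbB, hkb⟩, hcB⟩
      rwa [h0] at this
    have hkL : (h⁻¹ * g : Equiv.Perm P) '' L = L := by
      rw [hLdef, image_union, hkB, image_singleton, hku]
    calc g '' L = (h * (h⁻¹ * g) : Equiv.Perm P) '' L := by rw [mul_inv_cancel_left]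
      _ = h '' L := by rw [Equiv.Perm.coe_mul, image_comp, hkL]
  obtain ⟨b, hb⟩ := hBne
  have hbu : u ≠ b := by rintro rfl; exact huB hb
  have line_through : ∀ v ∈ X, ∃ M ∈ 𝓛, u ∈ M ∧ v ∈ M := by
    intro v hv
    obtain ⟨g, hg, hgu, hgb⟩ := hX_trans (hBsub hb) hv
    exact ⟨g '' L, image_mem g hg L hL_mem, ⟨u, huL, hgu⟩, ⟨b, hBL hb, hgb⟩⟩
  have neighbors : {v : P | v ≠ u ∧ ∃ M ∈ 𝓛, u ∈ M ∧ v ∈ M} = X := by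
    ext v
    constructor
    · rintro ⟨hvu, M, hM, huM, hvM⟩
      obtain ⟨g, hg, rfl, hgu⟩ := based hM huM
      obtain ⟨c, hc, rfl⟩ := hvM
      exact hX_inv hg hgu (hBsub (mem_B hc (by rintro rfl; exact hvu hgu)))
    · exact fun hv => ⟨by rintro rfl; exact huX hv, line_through v hv⟩
  have linear_iff : (∀ x y : P, x ≠ y → ∃! M, M ∈ 𝓛 ∧ x ∈ M ∧ y ∈ M) ↔
      (∀ x y x' y' : P, x ≠ y → x' ≠ y' → ∃ g ∈ G, g x = x' ∧ g y = y') := by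
    constructor
    · intro hlin x y x' y' hxy hxy'
      have hall : ∀ v, v ≠ u → v ∈ X := by
        intro v hv
        rw [← neighbors]
        exact ⟨hv, (hlin u v hv.symm).exists⟩
      obtain ⟨g, hg, hgx⟩ := htrans x u
      obtain ⟨h, hh, hhx⟩ := htrans x' u
      obtain ⟨k, hk, hku, hky⟩ := hX_trans (hall (g y) (by simpa [← hgx] using hxy.symm))
        (hall (h y') (by simpa [← hhx] using hxy'.symm))
      refine ⟨h⁻¹ * (k * g), G.mul_mem (G.inv_mem hh) (G.mul_mem hk hg), ?_, by simp [hky]⟩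
      rw [Equiv.Perm.mul_apply, Equiv.Perm.inv_eq_iff_eq, Equiv.Perm.mul_apply, hgx, hku, hhx]
    · intro h2 x y hxy
      obtain ⟨g, hg, hgu, hgb⟩ := h2 u b x y hbu hxy
      refine ⟨g '' L, ⟨image_mem g hg L hL_mem, ⟨u, huL, hgu⟩, ⟨b, hBL hb, hgb⟩⟩, ?_⟩
      rintro M ⟨hM, hxM, hyM⟩
      exact unique _ hM _ (image_mem g hg L hL_mem) x y hxy hxM hyM
        ⟨u, huL, hgu⟩ ⟨b, hBL hb, hgb⟩
  refine ⟨⟨?_, unique, ?_, neighbors⟩, linear_iff, ?_, ?_⟩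
  · intro M hM
    have := (ncard_pos (s := B)).2 ⟨b, hb⟩
    have := line_card M hM
    omega
  · refine fun g hg M => ⟨image_mem g hg M, fun hM => ?_⟩
    simpa [← image_comp, ← Equiv.Perm.coe_mul] using image_mem g⁻¹ (G.inv_mem hg) _ hM
  · intro hB1 hBX
    refine ⟨fun M hM => by have := line_card M hM; omega, fun x => ?_⟩
    obtain ⟨z, hzX, hzB⟩ := exists_mem_notMem_of_ncard_lt_ncard hBX
    obtain ⟨N, hN, huN, hzN⟩ := line_through z hzX
    have hzL : z ∉ L := fun h => hzB (mem_B h (by rintro rfl; exact huX hzX))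
    have hLN : L ≠ N := by rintro rfl; exact hzL hzN
    obtain ⟨g, hg, hgu⟩ := htrans u x
    have hne : g '' L ≠ g '' N := fun h => hLN (g.injective.image_injective h)
    rw [← ncard_pair hne]
    refine ncard_le_ncard ?_
    rintro M (rfl | rfl)
    · exact ⟨image_mem g hg L hL_mem, u, huL, hgu⟩
    · exact ⟨image_mem g hg N hN, u, huN, hgu⟩
  · intro hB1 _ h3
    refine ⟨fun hlin => h3.not_two_transitive (linear_iff.1 hlin), fun h => ?_⟩
    have := h L hL_mem
    omega
end

section
/- Let G be a permutation group of rank 3 on a finite set P, and let 𝓛₁ and 𝓛₂ be collections of subsets of P. Then the following are equivalent: (i) S := (P, 𝓛₁ ∪ 𝓛₂) is a linear space with at least three points on every line, G ≤ Aut(S), and 𝓛₁ and 𝓛₂ are distinct orbits of G on 𝓛₁ ∪ 𝓛₂; (ii) S₁ := (P, 𝓛₁) and S₂ := (P, 𝓛₂) are proper partial linear spaces with G ≤ Aut(S₁) and G ≤ Aut(S₂) such that the collinearity relations of S₁ and S₂ are disjoint. -/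
/-- Two points are collinear when they are distinct and lie on a common line. -/
def CollinearPair {P : Type*} (𝓛 : Set (Set P)) (x y : P) : Prop :=
  x ≠ y ∧ ∃ L ∈ 𝓛, x ∈ L ∧ y ∈ L

theorem mem_pairOrbit_symm {Ω : Type*} {G : Subgroup (Equiv.Perm Ω)} {z w : Ω × Ω}
    (h : w ∈ pairOrbit G z) : z ∈ pairOrbit G w := by
  obtain ⟨g, hg, h1, h2⟩ := h
  exact ⟨g⁻¹, G.inv_mem hg, by simp [← h1], by simp [← h2]⟩

theorem mem_pairOrbit_trans {Ω : Type*} {G : Subgroup (Equiv.Perm Ω)} {u v w : Ω × Ω}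
    (h : v ∈ pairOrbit G u) (h' : w ∈ pairOrbit G v) : w ∈ pairOrbit G u := by
  obtain ⟨g, hg, h1, h2⟩ := h
  obtain ⟨k, hk, h3, h4⟩ := h'
  exact ⟨k * g, G.mul_mem hk hg, by simp [h1, h3], by simp [h2, h4]⟩

/-- Three pairs in different orbits represent all orbits of a rank 3 group. -/
theorem IsRankThree.mem_pairOrbit_of_three {Ω : Type*} {G : Subgroup (Equiv.Perm Ω)}
    (hG : IsRankThree G) {u v w : Ω × Ω} (huv : v ∉ pairOrbit G u)
    (huw : w ∉ pairOrbit G u) (hvw : w ∉ pairOrbit G v) (z : Ω × Ω) :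
    z ∈ pairOrbit G u ∨ z ∈ pairOrbit G v ∨ z ∈ pairOrbit G w := by
  obtain ⟨-, a, b, c, -, -, -, h⟩ := hG
  have key : ∀ {o s t : Ω × Ω}, s ∈ pairOrbit G o → t ∈ pairOrbit G o → t ∈ pairOrbit G s :=
    fun hs ht => mem_pairOrbit_trans (mem_pairOrbit_symm hs) ht
  have hu := h u
  have hv := h v
  have hw := h w
  have hz := h z
  simp only [Set.mem_union] at hu hv hw hz
  grind

theorem CollinearPair.map {P : Type*} {G : Subgroup (Equiv.Perm P)} {𝓛 : Set (Set P)}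
    (hinv : ∀ g ∈ G, ∀ L : Set P, L ∈ 𝓛 ↔ g '' L ∈ 𝓛) {x y : P} (h : CollinearPair 𝓛 x y)
    {g : Equiv.Perm P} (hg : g ∈ G) : CollinearPair 𝓛 (g x) (g y) := by
  obtain ⟨hne, L, hL, hx, hy⟩ := h
  exact ⟨g.injective.ne hne, g '' L, (hinv g hg L).1 hL, Set.mem_image_of_mem g hx,
    Set.mem_image_of_mem g hy⟩

/-- If two nonempty disjoint collinearity relations are invariant under a rank 3 group, then they
cover all pairs of distinct points, and the group is transitive on the first one. -/
theorem IsRankThree.collinearPair_cover {P : Type*} {G : Subgroup (Equiv.Perm P)}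
    (hG : IsRankThree G) {𝓛₁ 𝓛₂ : Set (Set P)}
    (hinv₁ : ∀ g ∈ G, ∀ L : Set P, L ∈ 𝓛₁ ↔ g '' L ∈ 𝓛₁)
    (hinv₂ : ∀ g ∈ G, ∀ L : Set P, L ∈ 𝓛₂ ↔ g '' L ∈ 𝓛₂)
    (hdisj : ∀ x y, CollinearPair 𝓛₁ x y → ¬ CollinearPair 𝓛₂ x y)
    {a b c d : P} (hab : CollinearPair 𝓛₁ a b) (hcd : CollinearPair 𝓛₂ c d) :
    (∀ x y, x ≠ y → CollinearPair 𝓛₁ x y ∨ CollinearPair 𝓛₂ x y) ∧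
      ∀ x y, CollinearPair 𝓛₁ x y → ∃ g ∈ G, g a = x ∧ g b = y := by
  have hdiag : ∀ {x y : P}, x ≠ y → (x, y) ∉ pairOrbit G (a, a) := by
    rintro x y hne ⟨g, -, h1, h2⟩
    exact hne (h1.symm.trans h2)
  have horb : (c, d) ∉ pairOrbit G (a, b) := by
    rintro ⟨g, hg, rfl, rfl⟩
    exact hdisj _ _ (hab.map hinv₁ hg) hcd
  have h := hG.mem_pairOrbit_of_three (hdiag hab.1) (hdiag hcd.1) horb
  refine ⟨fun x y hne => ?_, fun x y hxy => ?_⟩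
  · rcases h (x, y) with h | ⟨g, hg, rfl, rfl⟩ | ⟨g, hg, rfl, rfl⟩
    · exact absurd h (hdiag hne)
    · exact .inl (hab.map hinv₁ hg)
    · exact .inr (hcd.map hinv₂ hg)
  · rcases h (x, y) with h | h | ⟨g, hg, rfl, rfl⟩
    · exact absurd h (hdiag hxy.1)
    · exact h
    · exact absurd (hcd.map hinv₂ hg) (hdisj _ _ hxy)

theorem exists_collinearPair {P : Type*} {𝓛 : Set (Set P)} {L : Set P} (hL : L ∈ 𝓛)
    (h : 2 ≤ L.ncard) : ∃ x y, CollinearPair 𝓛 x y ∧ x ∈ L ∧ y ∈ L := by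
  obtain ⟨x, y, hx, hy, hne⟩ := (Set.one_lt_ncard_iff (Set.finite_of_ncard_pos (by omega))).1 h
  exact ⟨x, y, ⟨hne, L, hL, hx, hy⟩, hx, hy⟩

/-- If a group is transitive on collinear pairs, then it is transitive on lines. -/
theorem lines_eq_orbit {P : Type*} {G : Subgroup (Equiv.Perm P)} {𝓛 : Set (Set P)}
    (hcard : ∀ L ∈ 𝓛, 2 ≤ L.ncard)
    (hpls : ∀ M₁ ∈ 𝓛, ∀ M₂ ∈ 𝓛, ∀ x y : P,
      x ≠ y → x ∈ M₁ → y ∈ M₁ → x ∈ M₂ → y ∈ M₂ → M₁ = M₂)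
    (hinv : ∀ g ∈ G, ∀ L : Set P, L ∈ 𝓛 ↔ g '' L ∈ 𝓛) {L : Set P} (hL : L ∈ 𝓛) {a b : P}
    (ha : a ∈ L) (hb : b ∈ L)
    (htrans : ∀ x y, CollinearPair 𝓛 x y → ∃ g ∈ G, g a = x ∧ g b = y) :
    𝓛 = {M : Set P | ∃ g ∈ G, M = g '' L} := by
  ext M
  constructor
  · intro hM
    obtain ⟨x, y, hxy, hx, hy⟩ := exists_collinearPair hM (hcard M hM)
    obtain ⟨g, hg, rfl, rfl⟩ := htrans x y hxy
    exact ⟨g, hg, hpls M hM _ ((hinv g hg L).1 hL) _ _ hxy.1 hx hy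
      (Set.mem_image_of_mem g ha) (Set.mem_image_of_mem g hb)⟩
  · rintro ⟨g, hg, rfl⟩
    exact (hinv g hg L).1 hL

theorem image_mem_orbit_iff {P : Type*} {G : Subgroup (Equiv.Perm P)} {𝓛 : Set (Set P)}
    {L : Set P} (h : 𝓛 = {M : Set P | ∃ g ∈ G, M = g '' L}) {g : Equiv.Perm P} (hg : g ∈ G)
    (M : Set P) : M ∈ 𝓛 ↔ g '' M ∈ 𝓛 := by
  subst h
  constructor
  · rintro ⟨k, hk, rfl⟩
    exact ⟨g * k, G.mul_mem hg hk, by simp [Set.image_image]⟩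
  · rintro ⟨k, hk, h⟩
    refine ⟨g⁻¹ * k, G.mul_mem (G.inv_mem hg) hk, ?_⟩
    have := congrArg (fun s => (g⁻¹ : Equiv.Perm P) '' s) h
    simpa [Set.image_image] using this

theorem orbit_eq_of_mem {P : Type*} {G : Subgroup (Equiv.Perm P)} {𝓛 : Set (Set P)}
    {L M : Set P} (h : 𝓛 = {M : Set P | ∃ g ∈ G, M = g '' L}) (hM : M ∈ 𝓛) :
    𝓛 = {N : Set P | ∃ g ∈ G, N = g '' M} := by
  have hM' := hM
  rw [h] at hM'
  obtain ⟨k, hk, rfl⟩ := hM'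
  ext N
  constructor
  · intro hN
    rw [h] at hN
    obtain ⟨g, hg, rfl⟩ := hN
    exact ⟨g * k⁻¹, G.mul_mem hg (G.inv_mem hk), by simp [Set.image_image]⟩
  · rintro ⟨g, hg, rfl⟩
    exact (image_mem_orbit_iff h hg _).1 hM

theorem three_le_ncard_of_orbit {P : Type*} {G : Subgroup (Equiv.Perm P)} {𝓛 : Set (Set P)}
    {L : Set P} (h : 𝓛 = {M : Set P | ∃ g ∈ G, M = g '' L}) (hL : 3 ≤ L.ncard) :
    ∀ M ∈ 𝓛, 3 ≤ M.ncard := by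
  intro M hM
  rw [h] at hM
  obtain ⟨g, -, rfl⟩ := hM
  rwa [Set.ncard_image_of_injective _ g.injective]

/-- One of two disjoint nonempty classes of lines of a linear space with at least three points on
every line is a proper partial linear space. -/
theorem isProper_of_linear_union {P : Type*} {𝓛₁ 𝓛₂ : Set (Set P)}
    (hcard : ∀ L ∈ 𝓛₁ ∪ 𝓛₂, 3 ≤ L.ncard)
    (hlin : ∀ x y : P, x ≠ y → ∃! L, L ∈ 𝓛₁ ∪ 𝓛₂ ∧ x ∈ L ∧ y ∈ L)
    (hdisj : ∀ L ∈ 𝓛₁, L ∉ 𝓛₂) {L₁ L₂ : Set P} (hL₁ : L₁ ∈ 𝓛₁) (hL₂ : L₂ ∈ 𝓛₂) :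
    (∀ L ∈ 𝓛₁, 2 ≤ L.ncard) ∧
      (∀ M₁ ∈ 𝓛₁, ∀ M₂ ∈ 𝓛₁, ∀ x y : P,
        x ≠ y → x ∈ M₁ → y ∈ M₁ → x ∈ M₂ → y ∈ M₂ → M₁ = M₂) ∧
      ¬ (∀ x y : P, x ≠ y → ∃! L, L ∈ 𝓛₁ ∧ x ∈ L ∧ y ∈ L) ∧
      ¬ (∀ L ∈ 𝓛₁, L.ncard = 2) := by
  refine ⟨fun L hL => ?_, fun M₁ hM₁ M₂ hM₂ x y hne hx hy hx' hy' => ?_, fun h => ?_, fun h => ?_⟩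
  · have := hcard L (.inl hL)
    omega
  · exact (hlin x y hne).unique ⟨.inl hM₁, hx, hy⟩ ⟨.inl hM₂, hx', hy'⟩
  · have := hcard L₂ (.inr hL₂)
    obtain ⟨x, y, ⟨hne, -⟩, hx, hy⟩ := exists_collinearPair hL₂ (by omega)
    obtain ⟨L, ⟨hL, hxL, hyL⟩, -⟩ := h x y hne
    have heq := (hlin x y hne).unique ⟨.inl hL, hxL, hyL⟩ ⟨.inr hL₂, hx, hy⟩
    exact hdisj L hL (heq ▸ hL₂)
  · have := hcard L₁ (.inl hL₁)
    have := h L₁ hL₁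
    omega

/-- **Lemma 2.14.** For a rank 3 permutation group `G` on a finite set `P` and collections
`𝓛₁, 𝓛₂` of subsets of `P`, the following are equivalent: (i) `(P, 𝓛₁ ∪ 𝓛₂)` is a linear
space with at least three points on every line admitting `G`, and `𝓛₁` and `𝓛₂` are
distinct orbits of `G` on `𝓛₁ ∪ 𝓛₂`; (ii) `(P, 𝓛₁)` and `(P, 𝓛₂)` are proper partial
linear spaces admitting `G` whose collinearity relations are disjoint. -/
theorem linear_space_split
    {P : Type*} [Finite P] [Nonempty P]
    (G : Subgroup (Equiv.Perm P)) (hG : IsRankThree G)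
    (𝓛₁ 𝓛₂ : Set (Set P)) :
    ((∀ L ∈ 𝓛₁ ∪ 𝓛₂, 3 ≤ L.ncard) ∧
     (∀ x y : P, x ≠ y → ∃! L, L ∈ 𝓛₁ ∪ 𝓛₂ ∧ x ∈ L ∧ y ∈ L) ∧
     (∀ g ∈ G, ∀ L : Set P, L ∈ 𝓛₁ ∪ 𝓛₂ ↔ g '' L ∈ 𝓛₁ ∪ 𝓛₂) ∧
     𝓛₁ ≠ 𝓛₂ ∧
     (∃ L ∈ 𝓛₁, 𝓛₁ = {M : Set P | ∃ g ∈ G, M = g '' L}) ∧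
     (∃ L ∈ 𝓛₂, 𝓛₂ = {M : Set P | ∃ g ∈ G, M = g '' L}))
    ↔
    (((∀ L ∈ 𝓛₁, 2 ≤ L.ncard) ∧
      (∀ M₁ ∈ 𝓛₁, ∀ M₂ ∈ 𝓛₁, ∀ x y : P,
        x ≠ y → x ∈ M₁ → y ∈ M₁ → x ∈ M₂ → y ∈ M₂ → M₁ = M₂) ∧
      ¬ (∀ x y : P, x ≠ y → ∃! L, L ∈ 𝓛₁ ∧ x ∈ L ∧ y ∈ L) ∧
      ¬ (∀ L ∈ 𝓛₁, L.ncard = 2) ∧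
      (∀ g ∈ G, ∀ L : Set P, L ∈ 𝓛₁ ↔ g '' L ∈ 𝓛₁)) ∧
     ((∀ L ∈ 𝓛₂, 2 ≤ L.ncard) ∧
      (∀ M₁ ∈ 𝓛₂, ∀ M₂ ∈ 𝓛₂, ∀ x y : P,
        x ≠ y → x ∈ M₁ → y ∈ M₁ → x ∈ M₂ → y ∈ M₂ → M₁ = M₂) ∧
      ¬ (∀ x y : P, x ≠ y → ∃! L, L ∈ 𝓛₂ ∧ x ∈ L ∧ y ∈ L) ∧
      ¬ (∀ L ∈ 𝓛₂, L.ncard = 2) ∧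
      (∀ g ∈ G, ∀ L : Set P, L ∈ 𝓛₂ ↔ g '' L ∈ 𝓛₂)) ∧
     ¬ ∃ x y : P, x ≠ y ∧ (∃ L ∈ 𝓛₁, x ∈ L ∧ y ∈ L) ∧ (∃ L ∈ 𝓛₂, x ∈ L ∧ y ∈ L)) := by
  constructor
  · rintro ⟨hcard, hlin, -, hne, ⟨L₁, hL₁, h₁⟩, ⟨L₂, hL₂, h₂⟩⟩
    have hdisj : ∀ L ∈ 𝓛₁, L ∉ 𝓛₂ := fun L hL hL' =>
      hne ((orbit_eq_of_mem h₁ hL).trans (orbit_eq_of_mem h₂ hL').symm)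
    obtain ⟨p1, p2, p3, p4⟩ := isProper_of_linear_union hcard hlin hdisj hL₁ hL₂
    rw [Set.union_comm] at hcard
    obtain ⟨q1, q2, q3, q4⟩ := isProper_of_linear_union hcard
      (by rwa [Set.union_comm]) (fun L hL hL' => hdisj L hL' hL) hL₂ hL₁
    refine ⟨⟨p1, p2, p3, p4, fun g hg L => image_mem_orbit_iff h₁ hg L⟩,
      ⟨q1, q2, q3, q4, fun g hg L => image_mem_orbit_iff h₂ hg L⟩, ?_⟩
    rintro ⟨x, y, hxy, ⟨L, hL, hx, hy⟩, ⟨M, hM, hx', hy'⟩⟩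
    have heq := (hlin x y hxy).unique ⟨.inl hL, hx, hy⟩ ⟨.inr hM, hx', hy'⟩
    exact hdisj L hL (heq ▸ hM)
  · rintro ⟨⟨hc₁, hp₁, -, hg₁, hi₁⟩, ⟨hc₂, hp₂, -, hg₂, hi₂⟩, hdisj⟩
    push Not at hg₁ hg₂
    obtain ⟨L₁, hL₁, hn₁⟩ := hg₁
    obtain ⟨L₂, hL₂, hn₂⟩ := hg₂
    have hthree₁ : 3 ≤ L₁.ncard := by have := hc₁ L₁ hL₁; omega
    have hthree₂ : 3 ≤ L₂.ncard := by have := hc₂ L₂ hL₂; omega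
    have hd : ∀ x y, CollinearPair 𝓛₁ x y → ¬ CollinearPair 𝓛₂ x y :=
      fun x y h h' => hdisj ⟨x, y, h.1, h.2, h'.2⟩
    obtain ⟨a, b, hab, ha, hb⟩ := exists_collinearPair hL₁ (hc₁ L₁ hL₁)
    obtain ⟨c, d, hcd, hc, hd'⟩ := exists_collinearPair hL₂ (hc₂ L₂ hL₂)
    obtain ⟨hcover, ht₁⟩ := hG.collinearPair_cover hi₁ hi₂ hd hab hcd
    obtain ⟨-, ht₂⟩ := hG.collinearPair_cover hi₂ hi₁ (fun x y h h' => hd x y h' h) hcd hab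
    have ho₁ := lines_eq_orbit hc₁ hp₁ hi₁ hL₁ ha hb ht₁
    have ho₂ := lines_eq_orbit hc₂ hp₂ hi₂ hL₂ hc hd' ht₂
    refine ⟨?_, fun x y hxy => ?_, fun g hg L => or_congr (hi₁ g hg L) (hi₂ g hg L), ?_,
      ⟨L₁, hL₁, ho₁⟩, ⟨L₂, hL₂, ho₂⟩⟩
    · rintro L (hL | hL)
      · exact three_le_ncard_of_orbit ho₁ hthree₁ L hL
      · exact three_le_ncard_of_orbit ho₂ hthree₂ L hL
    · rcases hcover x y hxy with ⟨-, L, hL, hx, hy⟩ | ⟨-, L, hL, hx, hy⟩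
      · refine ⟨L, ⟨.inl hL, hx, hy⟩, ?_⟩
        rintro M ⟨hM | hM, hx', hy'⟩
        · exact hp₁ M hM L hL x y hxy hx' hy' hx hy
        · exact absurd ⟨x, y, hxy, ⟨L, hL, hx, hy⟩, ⟨M, hM, hx', hy'⟩⟩ hdisj
      · refine ⟨L, ⟨.inr hL, hx, hy⟩, ?_⟩
        rintro M ⟨hM | hM, hx', hy'⟩
        · exact absurd ⟨x, y, hxy, ⟨M, hM, hx', hy'⟩, ⟨L, hL, hx, hy⟩⟩ hdisj
        · exact hp₂ M hM L hL x y hxy hx' hy' hx hy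
    · rintro rfl
      exact hd a b hab hab
end

section
/- Let V = V_d(p) with d ≥ 1 and p prime, and let S = (V, 𝓛) be a G-affine partial linear space where G is an affine permutation group on V, G is transitive on the line set 𝓛, and every line of S has at least 3 points. Suppose that one of the following holds: (i) there exist g ∈ G_0 and a line L ∈ 𝓛 containing 0 such that v^g = −v for all v ∈ L; (ii) p = 2; (iii) there exist x ∈ V \ {0} and L ∈ 𝓛 with L + x = L. Then every line of S is an affine subspace of V, i.e. a coset W + v of an F_p-subspace W of V. -/
open scoped Pointwise

/-- The orbit of `x` under the stabiliser of `0` in `G`. -/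
def zeroStabOrbit {V : Type*} [AddCommGroup V] (G : Subgroup (Equiv.Perm V)) (x : V) : Set V :=
  {y : V | ∃ g ∈ G, g 0 = 0 ∧ g x = y}

/-- `G` is an affine permutation group on `V`: it contains all translations, and every
element fixing `0` is additive. -/
def IsAffinePermGroup {V : Type*} [AddCommGroup V] (G : Subgroup (Equiv.Perm V)) : Prop :=
  (∀ v : V, Equiv.addRight v ∈ G) ∧
    ∀ g ∈ G, g 0 = 0 → ∀ x y : V, g (x + y) = g x + g y

/-- The stabiliser of `0` in `G` has exactly two orbits on the set of nonzero vectors;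
for an affine permutation group this says exactly that `G` has rank `3`. -/
def HasTwoZeroStabOrbits {V : Type*} [AddCommGroup V] (G : Subgroup (Equiv.Perm V)) : Prop :=
  ∃ x y : V, x ≠ 0 ∧ y ≠ 0 ∧ zeroStabOrbit G x ≠ zeroStabOrbit G y ∧
    ∀ z : V, z ≠ 0 → z ∈ zeroStabOrbit G x ∪ zeroStabOrbit G y

namespace PLS

variable {V : Type*}

theorem image_mem_lines_s9 (S : PLS V) {G : Subgroup (Equiv.Perm V)} (hG : G ≤ S.aut)
    {g : Equiv.Perm V} (hg : g ∈ G) {L : Set V} (hL : L ∈ S.lines) : g '' L ∈ S.lines := by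
  have h : g • S.lines = S.lines := MulAction.mem_stabilizer_iff.mp (hG hg)
  rw [← h]
  exact ⟨L, hL, rfl⟩

/-- If all translates of lines are lines, then a line stabilised by a nonzero translation
is a coset of a subgroup. -/
theorem exists_addSubgroup_of_translate_eq [AddCommGroup V] (S : PLS V)
    (htrans : ∀ L ∈ S.lines, ∀ v : V, (fun y : V => y + v) '' L ∈ S.lines)
    {L : Set V} (hL : L ∈ S.lines) {x : V} (hx : x ≠ 0)
    (hLx : (fun y : V => y + x) '' L = L) :
    ∃ (W : AddSubgroup V) (v : V), L = (fun w : V => w + v) '' (W : Set V) := by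
  have hmem : ∀ a ∈ L, a + x ∈ L := fun a ha => hLx ▸ Set.mem_image_of_mem _ ha
  have hdiff : ∀ a ∈ L, ∀ b ∈ L, ∀ c ∈ L, c + (b - a) ∈ L := by
    intro a ha b hb c hc
    have h : (fun y : V => y + (b - a)) '' L = L :=
      S.unique_of_pair _ (htrans L hL _) _ hL b (b + x) (by simpa using hx)
        ⟨a, ha, by simp⟩ ⟨a + x, hmem a ha, by simp only; abel⟩ hb (hmem b hb)
    rw [← h]
    exact ⟨c, hc, rfl⟩
  have hne : L.Nonempty := Set.nonempty_of_ncard_ne_zero (by have := S.two_le_ncard L hL; omega)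
  obtain ⟨v, hv⟩ := hne
  refine ⟨{ carrier := {u | u + v ∈ L}
            zero_mem' := by simpa using hv
            add_mem' := ?_
            neg_mem' := ?_ }, v, ?_⟩
  · intro a b ha hb
    have := hdiff v hv _ hb _ ha
    simp only [Set.mem_ofPred_eq] at *
    convert this using 1
    abel
  · intro a ha
    have := hdiff _ ha v hv v hv
    simp only [Set.mem_ofPred_eq] at *
    convert this using 1
    abel
  · ext y
    constructor
    · intro hy
      exact ⟨y - v, by simpa using hy, by simp⟩
    · rintro ⟨u, hu, rfl⟩
      exact hu

/-- If the negative of a line through `0` with at least three points is again a line, then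
that line is stabilised by a nonzero translation. -/
theorem exists_translate_eq_of_neg [AddCommGroup V] (S : PLS V)
    (htrans : ∀ L ∈ S.lines, ∀ v : V, (fun y : V => y + v) '' L ∈ S.lines)
    {L : Set V} (hL : L ∈ S.lines) (h3 : 3 ≤ L.ncard) (h0 : (0 : V) ∈ L)
    (hneg : (fun y : V => -y) '' L ∈ S.lines) :
    ∃ x : V, x ≠ 0 ∧ (fun y : V => y + x) '' L = L := by
  have key : ∀ v ∈ L, v ≠ 0 → (fun y : V => y + -v) '' L = (fun y : V => -y) '' L := by
    intro v hv hv0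
    exact S.unique_of_pair _ (htrans L hL _) _ hneg 0 (-v) (by simpa using hv0)
      ⟨v, hv, by simp⟩ ⟨0, h0, by simp⟩ ⟨0, h0, by simp⟩ ⟨v, hv, rfl⟩
  have hfin : L.Finite := Set.finite_of_ncard_pos (by omega)
  have hcard : 1 < (L \ {0}).ncard := by
    have := Set.ncard_sdiff_singleton_add_one h0 hfin
    omega
  obtain ⟨a, b, ⟨ha, ha0⟩, ⟨hb, hb0⟩, hab⟩ := (Set.one_lt_ncard_iff hfin.sdiff).mp hcard
  refine ⟨b - a, sub_ne_zero.mpr hab.symm, ?_⟩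
  have h := congrArg (fun T => (fun y : V => y + b) '' T) ((key a ha ha0).trans (key b hb hb0).symm)
  simp only [Set.image_image, neg_add_cancel_right, Set.image_id'] at h
  rw [← Set.image_congr (fun y _ => show y + -a + b = y + (b - a) by abel)]
  exact h

end PLS

/-- **Lemma 2.19.** Let `S = (V, 𝓛)` be a `G`-affine partial linear space, `G` an affine
permutation group on `V = V_d(p)` transitive on lines, with all lines of size at least 3.
If (i) some `g ∈ G₀` acts as `-1` on a line through `0`, or (ii) `p = 2`, or (iii) some
nonzero translation fixes a line setwise, then every line is an affine subspace of `V`. -/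
theorem lines_are_affine_subspaces
    {p d : ℕ} (hp : p.Prime) (hd : 1 ≤ d)
    (V : Type*) [AddCommGroup V] [Module (ZMod p) V] [Finite V]
    (hdim : Module.finrank (ZMod p) V = d)
    (S : PLS V)
    (G : Subgroup (Equiv.Perm V)) (hG : G ≤ S.aut)
    (haff : IsAffinePermGroup G)
    (hlinetrans : ∀ L ∈ S.lines, ∀ M ∈ S.lines, ∃ g ∈ G, g '' L = M)
    (h3 : ∀ L ∈ S.lines, 3 ≤ L.ncard)
    (hcase :
      (∃ g ∈ G, g 0 = 0 ∧ ∃ L ∈ S.lines, (0 : V) ∈ L ∧ ∀ v ∈ L, g v = -v) ∨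
      p = 2 ∨
      (∃ x : V, x ≠ 0 ∧ ∃ L ∈ S.lines, (fun y : V => y + x) '' L = L)) :
    ∀ L ∈ S.lines, ∃ (W : Submodule (ZMod p) V) (v : V),
      L = (fun w : V => w + v) '' (W : Set V) := by
  have htrans : ∀ L ∈ S.lines, ∀ v : V, (fun y : V => y + v) '' L ∈ S.lines :=
    fun L hL v => S.image_mem_lines_s9 hG (haff.1 v) hL
  intro M hM
  obtain ⟨x, hx, L, hL, hLx⟩ :
      ∃ x : V, x ≠ 0 ∧ ∃ L ∈ S.lines, (fun y : V => y + x) '' L = L := by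
    rcases hcase with ⟨g, hg, -, L, hL, h0, hgL⟩ | rfl | h
    · have hneg : (fun y : V => -y) '' L ∈ S.lines := by
        rw [← Set.image_congr hgL]
        exact S.image_mem_lines_s9 hG hg hL
      obtain ⟨x, hx, hLx⟩ := S.exists_translate_eq_of_neg htrans hL (h3 L hL) h0 hneg
      exact ⟨x, hx, L, hL, hLx⟩
    · obtain ⟨a, b, ha, hb, hab⟩ := (Set.one_lt_ncard_iff (Set.toFinite M)).mp
        (S.two_le_ncard M hM)
      have htwo : ∀ v : V, v + v = 0 := fun v => by
        rw [← two_smul (ZMod 2) v, show (2 : ZMod 2) = 0 from rfl, zero_smul]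
      refine ⟨b - a, sub_ne_zero.mpr hab.symm, M, hM, ?_⟩
      refine S.unique_of_pair _ (htrans M hM _) _ hM a b hab ⟨b, hb, ?_⟩ ⟨a, ha, by simp⟩ ha hb
      have h1 := htwo b
      have h2 := htwo a
      calc b + (b - a) = (b + b) - (a + a) + a := by abel
        _ = a := by rw [h1, h2]; simp
    · exact h
  obtain ⟨g, hg, rfl⟩ := hlinetrans L hL M hM
  have hadd : ∀ y z : V, g (y + z) = g y + (g z - g 0) := by
    intro y z
    have h := haff.2 (Equiv.addRight (-g 0) * g) (G.mul_mem (haff.1 _) hg) (by simp) y z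
    simp only [Equiv.Perm.mul_apply, Equiv.coe_addRight] at h
    calc g (y + z) = (g (y + z) + -g 0) + g 0 := by abel
      _ = _ := by rw [h]; abel
  have hgx : (fun y : V => y + (g x - g 0)) '' (g '' L) = g '' L := by
    conv_rhs => rw [← hLx]
    simp only [Set.image_image, hadd]
  obtain ⟨W, v, hW⟩ := S.exists_addSubgroup_of_translate_eq htrans hM
    (sub_ne_zero.mpr (g.injective.ne hx)) hgx
  exact ⟨AddSubgroup.toZModSubmodule p W, v, by simpa using hW⟩
end

section
/- Let V = V_n(q) with n ≥ 1 and q a prime power. Let (V, 𝓛) be a G-affine partial linear space, where G is an affine permutation group on V whose zero-stabilizer G_0 is contained in ΓL_n(q). Let L ∈ 𝓛 be a line containing 0 and let u ∈ L \ {0}. If ⟨u⟩ \ {0} ⊆ u^{G_0} (the F_q-span of u minus zero is contained in the G_0-orbit of u), then the set {λ ∈ F_q : λu ∈ L} is either {0, 1} or a subfield of F_q. -/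
open scoped Pointwise

section Counting

@[to_additive AddSubgroup.card_mul_dvd_sum]
theorem Subgroup.card_mul_dvd_sum {G : Type*} [Group G] [Fintype G] (U : Subgroup G)
    (f : G → ℕ) (hf : ∀ x, ∀ u ∈ U, f (x * u) = f x) (m : ℕ) (hm : ∀ x, m ∣ f x) :
    Nat.card U * m ∣ ∑ x, f x := by
  classical
  rw [← Finset.sum_fiberwise Finset.univ (fun x : G => (x : G ⧸ U)) f]
  refine Finset.dvd_sum fun q _ => ?_
  have hconst : ∀ x ∈ Finset.univ.filter (fun x : G => (x : G ⧸ U) = q), f x = f q.out := by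
    intro x hx
    rw [Finset.mem_filter, ← q.out_eq', eq_comm, QuotientGroup.eq] at hx
    simpa using hf q.out _ hx.2
  rw [Finset.sum_congr rfl hconst, Finset.sum_const, smul_eq_mul]
  refine mul_dvd_mul (dvd_of_eq ?_) (hm _)
  rw [Nat.card_eq_fintype_card, ← Finset.card_univ]
  refine Finset.card_bij (fun u _ => q.out * u) (fun u _ => ?_) (fun u _ v _ h => ?_)
    fun x hx => ?_
  · simp
  · simpa using h
  · rw [Finset.mem_filter, ← q.out_eq', eq_comm, QuotientGroup.eq] at hx
    exact ⟨⟨_, hx.2⟩, Finset.mem_univ _, by simp⟩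

theorem AddSubgroup.card_mul_card_dvd_card {X C : Type*} [Group X] [Finite X] [AddCommGroup C]
    [Finite C] (ind : X → C) (S : AddSubgroup C) (U : Subgroup X) (W : Finset X)
    (hU : ∀ x, ∀ u ∈ U, ind (x * u) = ind x) (hWU : ∀ w ∈ W, ∀ u ∈ U, w * u ∈ W)
    (hS : ∀ s ∈ S, ∃ g : X → X, Function.Injective g ∧
      ∀ w ∈ W, g w ∈ W ∧ ind (g w) = ind w + s) :
    Nat.card S * Nat.card U ∣ W.card := by
  classical
  have : Fintype X := Fintype.ofFinite X
  have : Fintype C := Fintype.ofFinite C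
  rw [Finset.card_eq_sum_card_fiberwise (f := ind) (t := Finset.univ) (fun _ _ => by simp)]
  have hle : ∀ c, ∀ s ∈ S, (W.filter (ind · = c)).card ≤ (W.filter (ind · = c + s)).card := by
    intro c s hs
    obtain ⟨g, hg, hgW⟩ := hS s hs
    refine Finset.card_le_card_of_injOn g (fun w hw => ?_) hg.injOn
    rw [Finset.mem_coe, Finset.mem_filter] at hw ⊢
    exact ⟨(hgW w hw.1).1, by rw [(hgW w hw.1).2, hw.2]⟩
  refine AddSubgroup.card_mul_dvd_sum S _ (fun c s hs => le_antisymm ?_ (hle c s hs)) _ fun c => ?_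
  · simpa using hle (c + s) (-s) (neg_mem hs)
  · have hmem : ∀ x, ∀ u ∈ U, x ∈ W.filter (ind · = c) → x * u ∈ W.filter (ind · = c) := by
      intro x u hu hx
      rw [Finset.mem_filter] at hx ⊢
      exact ⟨hWU x hx.1 u hu, by rw [hU x u hu, hx.2]⟩
    have := Subgroup.card_mul_dvd_sum U (fun x => if x ∈ W.filter (ind · = c) then 1 else 0)
      (fun x u hu => ?_) 1 (fun _ => one_dvd _)
    · rwa [mul_one, ← Finset.card_filter, Finset.filter_univ_mem] at this
    · refine if_congr ⟨fun h => ?_, hmem x u hu⟩ rfl rfl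
      simpa using hmem _ u⁻¹ (inv_mem hu) h

/-- If the partial geometric sums `∑ i < k, Q ^ i` represent every residue class modulo `j`, and
the sum with `t` terms vanishes modulo `j`, then `j ≤ t`. -/
theorem le_of_dvd_geom_sum {Q j t : ℕ} (hj : 0 < j) (ht : 0 < t)
    (hcover : ∀ n : ℕ, ∃ k : ℕ, n ≡ ∑ i ∈ Finset.range k, Q ^ i [MOD j])
    (hdvd : j ∣ ∑ i ∈ Finset.range t, Q ^ i) : j ≤ t := by
  have : NeZero j := ⟨hj.ne'⟩
  let s : ℕ → ZMod j := fun k => ∑ i ∈ Finset.range k, (Q : ZMod j) ^ i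
  have hst : s t = 0 := by
    have := (ZMod.natCast_eq_zero_iff _ _).2 hdvd
    simpa [s] using this
  have hQ : (Q : ZMod j) ^ t = 1 := by
    have := geom_sum_mul (Q : ZMod j) t
    rw [show ∑ i ∈ Finset.range t, (Q : ZMod j) ^ i = 0 from hst, zero_mul] at this
    exact (sub_eq_zero.1 this.symm)
  have hper : Function.Periodic s t := by
    intro k
    simp only [s]
    rw [add_comm, Finset.sum_range_add]
    simp only [pow_add, hQ, one_mul]
    rw [show ∑ i ∈ Finset.range t, (Q : ZMod j) ^ i = 0 from hst, zero_add]
  have hsurj : Function.Surjective fun k : Fin t => s k := by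
    intro x
    obtain ⟨k, hk⟩ := hcover x.val
    refine ⟨⟨k % t, Nat.mod_lt _ ht⟩, ?_⟩
    have := (ZMod.natCast_eq_natCast_iff _ _ _).2 hk
    simp only [ZMod.natCast_val, ZMod.cast_id', id_eq, Nat.cast_sum, Nat.cast_pow] at this
    simp only [hper.map_mod_nat, this, s]
  simpa using Fintype.card_le_of_surjective _ hsurj

theorem sq_add_one_lt_two_pow {t : ℕ} (ht : 5 ≤ t) : t ^ 2 + 1 < 2 ^ t := by
  induction t, ht using Nat.le_induction with
  | base => norm_num
  | succ n hn ih => rw [pow_succ 2]; nlinarith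

theorem mul_lt_sub_one_of_two_pow_le {k n t : ℕ} (hk : 2 ≤ k) (hkn : k ^ 2 ≤ n)
    (hn : 2 ^ t ≤ n) : (k - 1) * t < n - 1 := by
  obtain ⟨k, rfl⟩ := Nat.exists_eq_add_of_le' (show 1 ≤ k by omega)
  obtain ⟨n, rfl⟩ := Nat.exists_eq_add_of_le' (show 1 ≤ n by nlinarith)
  simp only [Nat.add_sub_cancel]
  by_contra! h
  have hle : k + 2 ≤ t := by
    by_contra! h'
    nlinarith [Nat.mul_le_mul_left k (show t ≤ k + 1 by omega)]
  rcases le_or_gt 5 t with h5 | h5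
  · have := sq_add_one_lt_two_pow h5
    nlinarith
  · have : k ≤ 2 := by omega
    interval_cases t <;> interval_cases k <;> omega

end Counting

section SemilinearAction

variable {F : Type*} [Field F]

/-- The relation `H` describes a group of semilinear maps `x ↦ a * σ x` of the one-dimensional
space `F` which is transitive on the nonzero elements: `H a σ` says that this map is in the
group. -/
structure IsTransitiveSemilinear (H : F → RingAut F → Prop) : Prop where
  ne_zero : ∀ {a σ}, H a σ → a ≠ 0
  one : H 1 1
  mul : ∀ {a b σ τ}, H a σ → H b τ → H (a * σ b) (σ * τ)
  inv : ∀ {a σ}, H a σ → H (σ⁻¹ a⁻¹) σ⁻¹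
  exists_rel : ∀ a, a ≠ 0 → ∃ σ, H a σ

namespace IsTransitiveSemilinear

variable {H : F → RingAut F → Prop} (hH : IsTransitiveSemilinear H)

include hH

/-- The group of field automorphisms occurring in a transitive semilinear group. -/
def autSubgroup : Subgroup (RingAut F) where
  carrier := {σ | ∃ a, H a σ}
  one_mem' := ⟨1, hH.one⟩
  mul_mem' := fun ⟨_, ha⟩ ⟨_, hb⟩ => ⟨_, hH.mul ha hb⟩
  inv_mem' := fun ⟨_, ha⟩ => ⟨_, hH.inv ha⟩

/-- The scalars whose multiplication map lies in a transitive semilinear group. -/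
def scalars : Subgroup Fˣ where
  carrier := {a | H a 1}
  one_mem' := hH.one
  mul_mem' := fun ha hb => by simpa using hH.mul ha hb
  inv_mem' := fun ha => by simpa using hH.inv ha

theorem mem_scalars {a : Fˣ} : a ∈ hH.scalars ↔ H a 1 := Iff.rfl

theorem div_mem_scalars {a b : Fˣ} {σ : RingAut F} (ha : H a σ) (hb : H b σ) :
    a / b ∈ hH.scalars := by
  rw [mem_scalars]
  simpa [div_eq_mul_inv] using hH.mul ha (hH.inv hb)

end IsTransitiveSemilinear

/-- The field automorphism `φ` generates the automorphisms occurring in `H`, and is the Frobenius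
automorphism over their common fixed field `E`. -/
structure IsFrobeniusGenerator (H : F → RingAut F → Prop) (E : Subfield F) (φ : RingAut F) :
    Prop where
  apply_of_mem : ∀ {a σ}, H a σ → ∀ x ∈ E, σ x = x
  apply_eq_pow : ∀ x, φ x = x ^ Nat.card E
  exists_scalar : ∃ a, H a φ
  exists_pow : ∀ a, a ≠ 0 → ∃ k : ℕ, H a (φ ^ k)

theorem IsFrobeniusGenerator.pow_apply {H : F → RingAut F → Prop} {E : Subfield F} {φ : RingAut F}
    (hφ : IsFrobeniusGenerator H E φ) (k : ℕ) (x : F) :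
    (φ ^ k) x = x ^ Nat.card E ^ k := by
  induction k with
  | zero => simp
  | succ k ih => rw [pow_succ, RingAut.mul_apply, hφ.apply_eq_pow, map_pow, ih, ← pow_mul, pow_succ]

namespace IsTransitiveSemilinear

variable {H : F → RingAut F → Prop} (hH : IsTransitiveSemilinear H)

include hH

theorem exists_isFrobeniusGenerator [Finite F] : ∃ E φ, IsFrobeniusGenerator H E φ := by
  have : Fintype F := Fintype.ofFinite F
  let Γ := hH.autSubgroup
  have : Finite (RingAut F) := Finite.of_injective (fun σ : RingAut F => (σ : F → F))
    DFunLike.coe_injective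
  let E := FixedPoints.subfield Γ F
  have : Fintype E := Fintype.ofFinite E
  have hbij := FixedPoints.toAlgAut_bijective Γ F
  obtain ⟨φ, hφ⟩ := hbij.surjective (FiniteField.frobeniusAlgEquivOfAlgebraic E F)
  refine ⟨E, φ, ⟨fun {a σ} h x hx => hx ⟨σ, a, h⟩, fun x => ?_, φ.2, fun a ha => ?_⟩⟩
  · have := DFunLike.congr_fun hφ x
    rw [Nat.card_eq_fintype_card]
    exact this
  · obtain ⟨σ, hσ⟩ := hH.exists_rel a ha
    obtain ⟨k, hk⟩ := (FiniteField.bijective_frobeniusAlgEquivOfAlgebraic_pow E F).surjective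
      (MulSemiringAction.toAlgAut Γ E F ⟨σ, a, hσ⟩)
    refine ⟨k, ?_⟩
    dsimp only at hk
    rw [← hφ, ← map_pow] at hk
    have := hbij.injective hk
    have := congrArg Subtype.val this
    rw [Subgroup.coe_pow] at this
    rwa [this]

variable {E : Subfield F} {φ : RingAut F} (hφ : IsFrobeniusGenerator H E φ)

include hφ

theorem rel_geom_sum {a : F} (ha : H a φ) (k : ℕ) :
    H (a ^ ∑ i ∈ Finset.range k, Nat.card E ^ i) (φ ^ k) := by
  induction k with
  | zero => simpa using hH.one
  | succ k ih =>
    have := hH.mul ih ha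
    rwa [hφ.pow_apply, ← pow_add, ← Finset.sum_range_succ, ← pow_succ] at this

/-- The coset of the scalar subgroup containing `a` is determined by the class of any `k` such that
`x ↦ a * (φ ^ k) x` belongs to the group, and these classes form a finite abelian group. -/
theorem exists_index [Finite F] : ∃ (C : Type) (_ : AddCommGroup C) (_ : Finite C) (ind : Fˣ → C),
    Function.Surjective ind ∧ (∀ a b, ind a = ind b ↔ a / b ∈ hH.scalars) ∧
    ∀ (a b c : Fˣ) (k : ℕ), H a (φ ^ k) → (c : F) = a * (φ ^ k) b → ind c = ind a + ind b := by
  obtain ⟨a₀, ha₀⟩ := hφ.exists_scalar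
  let D : AddSubgroup ℤ :=
    { carrier := {k | H 1 (φ ^ k)}
      zero_mem' := by simpa using hH.one
      add_mem' := fun {k l} hk hl => by simpa [zpow_add] using hH.mul hk hl
      neg_mem' := fun {k} hk => by simpa [zpow_neg] using hH.inv hk }
  have hD : ∀ k, k ∈ D ↔ H 1 (φ ^ k) := fun k => Iff.rfl
  have hex : ∀ a : Fˣ, ∃ k : ℤ, H a (φ ^ k) := fun a => by
    obtain ⟨k, hk⟩ := hφ.exists_pow a a.ne_zero
    exact ⟨k, by simpa using hk⟩
  choose i hi using hex
  have hind : ∀ (a : Fˣ) (k : ℤ), (i a : ℤ ⧸ D) = k ↔ H a (φ ^ k) := by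
    intro a k
    rw [QuotientAddGroup.eq, hD]
    constructor
    · intro h
      simpa [← zpow_add] using hH.mul (hi a) h
    · intro h
      have := hH.mul (hH.inv (hi a)) h
      rwa [← map_mul, inv_mul_cancel₀ a.ne_zero, map_one, ← zpow_neg, ← zpow_add] at this
  have hsurj : Function.Surjective fun a : Fˣ => (i a : ℤ ⧸ D) := by
    intro c
    obtain ⟨k, rfl⟩ := QuotientAddGroup.mk_surjective c
    obtain ⟨a, ha⟩ := hH.autSubgroup.zpow_mem ⟨a₀, ha₀⟩ k
    exact ⟨Units.mk0 a (hH.ne_zero ha), (hind _ _).2 ha⟩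
  refine ⟨ℤ ⧸ D, inferInstance, Finite.of_surjective _ hsurj, fun a => i a, hsurj,
    fun a b => ?_, fun a b c k ha hc => ?_⟩
  · rw [hind]
    constructor
    · intro h
      exact hH.div_mem_scalars h (hi b)
    · intro h
      simpa using hH.mul h (hi b)
  · have := hH.mul ha (hi b)
    rw [← hc, ← zpow_natCast, ← zpow_add] at this
    have h1 := (hind c _).2 this
    have h2 := (hind a k).2 (by simpa using ha)
    dsimp only
    rw [h1, h2, QuotientAddGroup.mk_add]

theorem units_mem_scalars [Finite F] {x : Fˣ} (hx : (x : F) ∈ E) : x ∈ hH.scalars := by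
  obtain ⟨a, ha⟩ := hφ.exists_scalar
  obtain ⟨y, hy⟩ := FiniteField.norm_surjective E F ⟨x, hx⟩
  have hM := FiniteField.algebraMap_norm_eq_pow_sum E F y
  rw [hy] at hM
  have hy0 : y ≠ 0 := by
    rintro rfl
    rw [Algebra.norm_zero] at hy
    exact x.ne_zero (congrArg Subtype.val hy).symm
  set M := Module.finrank E F
  have hφM : φ ^ M = 1 := by
    ext z
    have : Fintype F := Fintype.ofFinite F
    rw [hφ.pow_apply, ← Module.natCard_eq_pow_finrank (K := E) (V := F),
      Nat.card_eq_fintype_card, FiniteField.pow_card, RingAut.one_apply]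
  let u : Fˣ := Units.mk0 a (hH.ne_zero ha)
  let v : Fˣ := Units.mk0 y hy0
  obtain ⟨k, hk⟩ := hφ.exists_pow y hy0
  have hu : u ^ ∑ i ∈ Finset.range M, Nat.card E ^ i ∈ hH.scalars := by
    rw [mem_scalars, ← hφM]
    exact hH.rel_geom_sum hφ ha M
  have hv : v / u ^ ∑ i ∈ Finset.range k, Nat.card E ^ i ∈ hH.scalars :=
    hH.div_mem_scalars (σ := φ ^ k) hk (hH.rel_geom_sum hφ ha k)
  have hxv : x = v ^ ∑ i ∈ Finset.range M, Nat.card E ^ i := Units.ext hM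
  rw [hxv, ← div_mul_cancel v (u ^ ∑ i ∈ Finset.range k, Nat.card E ^ i), mul_pow, ← pow_mul,
    mul_comm (∑ i ∈ Finset.range k, _), pow_mul]
  exact mul_mem (pow_mem hv _) (pow_mem hu _)

theorem exists_modEq_geom_sum [Finite F] (n : ℕ) :
    ∃ k, n ≡ ∑ i ∈ Finset.range k, Nat.card E ^ i [MOD hH.scalars.index] := by
  obtain ⟨a, ha⟩ := hφ.exists_scalar
  let u : Fˣ := Units.mk0 a (hH.ne_zero ha)
  have hcover : ∀ v : Fˣ, ∃ k, (v : Fˣ ⧸ hH.scalars) =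
      (u : Fˣ ⧸ hH.scalars) ^ ∑ i ∈ Finset.range k, Nat.card E ^ i := fun v => by
    obtain ⟨k, hk⟩ := hφ.exists_pow v v.ne_zero
    refine ⟨k, ?_⟩
    rw [← QuotientGroup.mk_pow, eq_comm, QuotientGroup.eq, mul_comm, ← div_eq_mul_inv]
    exact hH.div_mem_scalars hk (hH.rel_geom_sum hφ ha k)
  obtain ⟨k, hk⟩ := hcover (u ^ n)
  refine ⟨k, ?_⟩
  rw [QuotientGroup.mk_pow, pow_eq_pow_iff_modEq, orderOf_eq_card_of_forall_mem_zpowers] at hk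
  · exact hk
  · intro x
    obtain ⟨v, rfl⟩ := QuotientGroup.mk_surjective x
    obtain ⟨l, hl⟩ := hcover v
    exact hl ▸ pow_mem (Subgroup.mem_zpowers _) _

end IsTransitiveSemilinear

/-- The field of multipliers of an additive subgroup of a finite field. -/
def AddSubgroup.multipliers [Finite F] (A : AddSubgroup F) : Subfield F where
  carrier := {k | ∀ a ∈ A, k * a ∈ A}
  one_mem' := fun a ha => by simpa using ha
  zero_mem' := fun a _ => by simp
  add_mem' := fun hk hl a ha => by
    rw [add_mul]
    exact add_mem (hk a ha) (hl a ha)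
  neg_mem' := fun hk a ha => by
    rw [neg_mul]
    exact neg_mem (hk a ha)
  mul_mem' := fun hk hl a ha => by
    rw [mul_assoc]
    exact hk _ (hl a ha)
  inv_mem' := fun k hk a ha => by
    rcases eq_or_ne k 0 with rfl | hk0
    · simp
    obtain ⟨b, hb⟩ := (Finite.injective_iff_surjective
      (f := fun b : A => (⟨k * b, hk b b.2⟩ : A))).1
      (fun b c h => Subtype.ext (mul_left_cancel₀ hk0 (congrArg Subtype.val h))) ⟨a, ha⟩
    have hb : k * b = a := congrArg Subtype.val hb
    rw [← hb, inv_mul_cancel_left₀ hk0]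
    exact b.2

theorem AddSubgroup.mem_multipliers [Finite F] {A : AddSubgroup F} {k : F} :
    k ∈ A.multipliers ↔ ∀ a ∈ A, k * a ∈ A := Iff.rfl

theorem AddSubgroup.multipliers_le [Finite F] {A : AddSubgroup F} (h1 : (1 : F) ∈ A) {k : F}
    (hk : k ∈ A.multipliers) : k ∈ A := by
  simpa using hk 1 h1

theorem AddSubgroup.card_multipliers_sq_le [Finite F] {A : AddSubgroup F} (h1 : (1 : F) ∈ A)
    {z : F} (hz : z ∈ A) (hzk : z ∉ A.multipliers) :
    Nat.card A.multipliers ^ 2 ≤ Nat.card A := by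
  rw [sq, ← Nat.card_prod]
  refine Nat.card_le_card_of_injective (fun p : A.multipliers × A.multipliers =>
    (⟨p.1 + p.2 * z, add_mem (multipliers_le h1 p.1.2) (p.2.2 z hz)⟩ : A)) ?_
  rintro ⟨x, y⟩ ⟨x', y'⟩ h
  have h : (x : F) + y * z = x' + y' * z := congrArg Subtype.val h
  have hy : y = y' := by
    by_contra hne
    have hne' : (y : F) - y' ≠ 0 := sub_ne_zero.2 fun h' => hne (Subtype.ext h')
    apply hzk
    have : z = ((x' : F) - x) / (y - y') := by
      rw [eq_div_iff hne']
      linear_combination h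
    rw [this]
    exact div_mem (sub_mem x'.2 x.2) (sub_mem y.2 y'.2)
  subst hy
  exact Prod.ext (Subtype.ext (add_right_cancel h)) rfl

theorem AddSubgroup.two_pow_finrank_span_le [Finite F] (E : Subfield F) (A : AddSubgroup F) :
    2 ^ Module.finrank E (Submodule.span E (A : Set F)) ≤ Nat.card A := by
  classical
  obtain ⟨f, hfA, -, hf⟩ := Submodule.exists_fun_fin_finrank_span_eq (K := E) (s := (A : Set F))
  generalize Module.finrank E (Submodule.span E (A : Set F)) = t at f hfA hf ⊢
  have hcard : Nat.card (Finset (Fin t)) = 2 ^ t := by simp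
  rw [← hcard]
  refine Nat.card_le_card_of_injective
    (fun s : Finset (Fin t) => (⟨∑ i ∈ s, f i, sum_mem fun i _ => hfA i⟩ : A)) ?_
  intro s s' h
  have h : ∑ i ∈ s, f i = ∑ i ∈ s', f i := congrArg Subtype.val h
  rw [Fintype.linearIndependent_iff] at hf
  have h0 := hf (fun i => (if i ∈ s then 1 else 0) - if i ∈ s' then 1 else 0) (by
    simp [sub_smul, Finset.sum_sub_distrib, ite_smul, h])
  ext i
  have := h0 i
  by_cases h1 : i ∈ s <;> by_cases h2 : i ∈ s' <;> simp_all

theorem card_filter_units_add_one [Fintype F] [DecidableEq F] (S : Set F) [DecidablePred (· ∈ S)]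
    (h0 : (0 : F) ∈ S) :
    (Finset.univ.filter fun x : Fˣ => (x : F) ∈ S).card + 1 = Nat.card S := by
  rw [Nat.card_coe_set_eq, ← Set.ncard_sdiff_singleton_add_one h0,
    ← Finset.card_image_of_injective _ Units.val_injective, ← Set.ncard_coe_finset]
  congr 2
  ext x
  constructor
  · simp only [Finset.coe_image, Set.mem_image, Finset.mem_coe, Finset.mem_filter]
    rintro ⟨u, ⟨-, hu⟩, rfl⟩
    exact ⟨hu, u.ne_zero⟩
  · rintro ⟨hx, hx0⟩
    simp only [Finset.coe_image, Set.mem_image, Finset.mem_coe, Finset.mem_filter]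
    exact ⟨Units.mk0 x hx0, ⟨Finset.mem_univ _, hx⟩, rfl⟩

theorem IsTransitiveSemilinear.multipliers_eq [Finite F] {H : F → RingAut F → Prop}
    (hH : IsTransitiveSemilinear H) (A : AddSubgroup F) (h1 : (1 : F) ∈ A)
    (hA : ∀ a σ, H a σ → ∀ x ∈ A, x ≠ 0 → a * σ x ∈ A → ∀ z, a * σ z ∈ A ↔ z ∈ A) :
    (A : Set F) = A.multipliers := by
  classical
  have : Fintype F := Fintype.ofFinite F
  refine Set.Subset.antisymm (fun z hz => ?_) fun k hk => AddSubgroup.multipliers_le h1 hk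
  by_contra hzk
  obtain ⟨E, φ, hφ⟩ := hH.exists_isFrobeniusGenerator
  obtain ⟨C, _, _, ind, hsurj, hind, hadd⟩ := hH.exists_index hφ
  have hA1 : ∀ {a : Fˣ} {k : ℕ}, (a : F) ∈ A → H a (φ ^ k) → ∀ z, a * (φ ^ k) z ∈ A ↔ z ∈ A :=
    fun ha h => hA _ _ h 1 h1 one_ne_zero (by simpa using ha)
  have hind1 : ind 1 = 0 := by
    have := hadd 1 1 1 0 (by simpa using hH.one) (by simp)
    simpa using this
  let S : AddSubgroup C :=
    { carrier := {c | ∃ a : Fˣ, (a : F) ∈ A ∧ ind a = c}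
      zero_mem' := ⟨1, h1, hind1⟩
      add_mem' := by
        rintro _ _ ⟨a, ha, rfl⟩ ⟨b, hb, rfl⟩
        obtain ⟨k, hk⟩ := hφ.exists_pow a a.ne_zero
        have hb0 : (a : F) * (φ ^ k) b ≠ 0 :=
          mul_ne_zero a.ne_zero (EmbeddingLike.map_ne_zero_iff.2 b.ne_zero)
        exact ⟨Units.mk0 _ hb0, (hA1 ha hk b).2 hb, hadd a b _ k hk rfl⟩
      neg_mem' := by
        rintro _ ⟨a, ha, rfl⟩
        obtain ⟨k, hk⟩ := hφ.exists_pow a a.ne_zero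
        have hc0 : (φ ^ k).symm (a : F)⁻¹ ≠ 0 :=
          EmbeddingLike.map_ne_zero_iff.2 (inv_ne_zero a.ne_zero)
        have hc : (a : F) * (φ ^ k) ((φ ^ k).symm (a : F)⁻¹) = 1 := by
          rw [RingEquiv.apply_symm_apply, mul_inv_cancel₀ a.ne_zero]
        refine ⟨Units.mk0 _ hc0, (hA1 ha hk _).1 (hc.symm ▸ h1), ?_⟩
        have := hadd a (Units.mk0 _ hc0) 1 k hk hc.symm
        rw [hind1] at this
        exact (neg_eq_of_add_eq_zero_right this.symm).symm }
  let U : Subgroup Fˣ :=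
    { carrier := {u | (u : F) ∈ E}
      one_mem' := E.one_mem
      mul_mem' := fun hu hv => E.mul_mem hu hv
      inv_mem' := fun {u} hu => by simpa using E.inv_mem hu }
  let W := Submodule.span E (A : Set F)
  have hW : Nat.card W = Nat.card E ^ Module.finrank E W := Module.natCard_eq_pow_finrank
  have ht : 0 < Module.finrank E W := by
    have h1W : (1 : F) ∈ W := Submodule.subset_span h1
    have : Nontrivial W := ⟨⟨1, h1W⟩, 0, fun h => one_ne_zero (congrArg Subtype.val h)⟩
    exact Module.finrank_pos
  have hWcard := card_filter_units_add_one (W : Set F) W.zero_mem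
  have hUcard := card_filter_units_add_one (E : Set F) E.zero_mem
  have hU : Nat.card U = (Finset.univ.filter fun x : Fˣ => (x : F) ∈ (E : Set F)).card := by
    rw [Nat.card_eq_fintype_card, Fintype.card_subtype]
    rfl
  have hdvd := AddSubgroup.card_mul_card_dvd_card ind S U
    (Finset.univ.filter fun x : Fˣ => (x : F) ∈ (W : Set F)) (fun x u hu => ?_)
    (fun w hw u hu => ?_) ?_
  rotate_left
  · rw [hind, mul_div_cancel_left]
    exact hH.units_mem_scalars hφ hu
  · rw [Finset.mem_filter] at hw ⊢
    refine ⟨Finset.mem_univ _, ?_⟩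
    rw [Units.val_mul, mul_comm]
    exact W.smul_mem (⟨u, hu⟩ : E) hw.2
  · rintro _ ⟨a, ha, rfl⟩
    obtain ⟨k, hk⟩ := hφ.exists_pow a a.ne_zero
    refine ⟨fun w => a * Units.map ((φ ^ k : RingAut F) : F →* F) w, fun v w h => ?_,
      fun w hw => ⟨?_, ?_⟩⟩
    · exact Units.ext ((φ ^ k).injective (congrArg Units.val (mul_left_cancel h)))
    · rw [Finset.mem_filter] at hw ⊢
      refine ⟨Finset.mem_univ _, ?_⟩
      change (a : F) * (φ ^ k) w ∈ W
      refine Submodule.span_induction (p := fun w _ => (a : F) * (φ ^ k) w ∈ W)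
        (fun x hx => Submodule.subset_span ((hA1 ha hk x).2 hx)) (by simp) (fun x y _ _ hx hy => ?_)
        (fun c x _ hx => ?_) hw.2
      · rw [map_add, mul_add]
        exact add_mem hx hy
      · rw [Subfield.smul_def, smul_eq_mul, map_mul, hφ.apply_of_mem hk c c.2, mul_left_comm]
        exact W.smul_mem c hx
    · rw [hadd a w _ k hk rfl, add_comm]
  have hindex : hH.scalars.index = Nat.card C := by
    refine Nat.card_congr (Equiv.ofBijective (Quotient.lift ind fun a b h => ?_) ⟨?_, fun c => ?_⟩)
    · rw [eq_comm, hind, div_eq_mul_inv, mul_comm]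
      exact QuotientGroup.leftRel_apply.1 h
    · intro x y
      induction x using Quotient.inductionOn with | _ x
      induction y using Quotient.inductionOn with | _ y
      intro h
      refine Quotient.sound (QuotientGroup.leftRel_apply.2 ?_)
      rw [mul_comm, ← div_eq_mul_inv, ← hind]
      exact h.symm
    · obtain ⟨a, rfl⟩ := hsurj c
      exact ⟨Quotient.mk _ a, rfl⟩
  have hSt : Nat.card S ≤ Module.finrank E W := by
    refine le_of_dvd_geom_sum (Q := Nat.card E) Nat.card_pos ht (fun n => ?_) ?_
    · obtain ⟨k, hk⟩ := hH.exists_modEq_geom_sum hφ n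
      exact ⟨k, hk.of_dvd (hindex ▸ S.card_addSubgroup_dvd_card)⟩
    · have hEpos : 0 < Nat.card U := Nat.card_pos
      have hQ : Nat.card E = Nat.card U + 1 := by
        rw [hU, hUcard]
        rfl
      refine Nat.dvd_of_mul_dvd_mul_right hEpos ?_
      convert hdvd using 1
      refine Nat.add_right_cancel (m := 1) ?_
      rw [hWcard, hQ, geom_sum_mul_add, ← hQ]
      exact hW.symm
  have hAcard := card_filter_units_add_one (A : Set F) A.zero_mem
  have hKcard := card_filter_units_add_one (A.multipliers : Set F) A.multipliers.zero_mem
  have hle := Finset.card_le_mul_card_image (f := ind)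
    (Finset.univ.filter fun x : Fˣ => (x : F) ∈ (A : Set F))
    (Finset.univ.filter fun x : Fˣ => (x : F) ∈ (A.multipliers : Set F)).card (fun c hc => ?_)
  rotate_left
  · obtain ⟨a, ha, rfl⟩ := Finset.mem_image.1 hc
    rw [Finset.mem_filter] at ha
    refine Finset.card_le_card_of_injOn (fun b => b / a) (fun b hb => ?_)
      (div_left_injective (b := a)).injOn
    rw [Finset.mem_coe, Finset.mem_filter, Finset.mem_filter, hind] at hb
    rw [Finset.mem_coe, Finset.mem_filter]
    refine ⟨Finset.mem_univ _, fun z hz => ?_⟩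
    exact (hA _ _ (hH.mem_scalars.1 hb.2) a ha.2 a.ne_zero (by simpa using hb.1.2) z).2 hz
  have himage : (Finset.image ind (Finset.univ.filter fun x : Fˣ => (x : F) ∈ (A : Set F))).card ≤
      Nat.card S := by
    rw [← Set.ncard_coe_finset]
    refine Set.ncard_le_ncard (t := (S : Set C)) (fun c hc => ?_)
    obtain ⟨a, ha, rfl⟩ := Finset.mem_image.1 hc
    exact ⟨a, (Finset.mem_filter.1 ha).2, rfl⟩
  have hlt := mul_lt_sub_one_of_two_pow_le (k := Nat.card A.multipliers) (Finite.one_lt_card)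
    (AddSubgroup.card_multipliers_sq_le h1 hz hzk) (A.two_pow_finrank_span_le E)
  refine hlt.not_ge ?_
  calc Nat.card A - 1 = _ := Nat.sub_eq_of_eq_add hAcard.symm
    _ ≤ _ := hle
    _ ≤ _ := Nat.mul_le_mul (Nat.le_sub_of_add_le hKcard.le) (himage.trans hSt)

theorem IsTransitiveSemilinear.eq_pair_or_exists_subfield [Finite F] {H : F → RingAut F → Prop}
    (hH : IsTransitiveSemilinear H) (A : Set F) (h0 : (0 : F) ∈ A) (h1 : (1 : F) ∈ A)
    (hA : ∀ a σ, H a σ → ∀ t, ∀ x ∈ A, ∀ y ∈ A, x ≠ y → a * σ x + t ∈ A → a * σ y + t ∈ A →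
      ∀ z, a * σ z + t ∈ A ↔ z ∈ A) :
    A = {0, 1} ∨ ∃ K : Subfield F, A = K := by
  by_cases hA2 : A ⊆ {0, 1}
  · exact Or.inl (hA2.antisymm (Set.insert_subset h0 (Set.singleton_subset_iff.2 h1)))
  obtain ⟨w, hw, hw01⟩ := Set.not_subset.1 hA2
  rw [Set.mem_insert_iff, Set.mem_singleton_iff, not_or] at hw01
  obtain ⟨E, φ, hφ⟩ := hH.exists_isFrobeniusGenerator
  have hneg : H (-1) 1 :=
    hH.units_mem_scalars hφ (x := -1) (by simp)
  have hrefl : ∀ x ∈ A, ∀ y ∈ A, x ≠ y → ∀ z ∈ A, x + y - z ∈ A := by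
    intro x hx y hy hxy z hz
    have := (hA _ _ hneg (x + y) x hx y hy hxy (by simpa using hy) (by simpa using hx) z).2 hz
    rwa [RingAut.one_apply, neg_one_mul, neg_add_eq_sub] at this
  have hthird : ∀ x y : F, ∃ a ∈ A, a ≠ x ∧ a ≠ y := by
    intro x y
    by_contra! h
    rcases eq_or_ne 0 x with rfl | hx
    · exact hw01.2 ((h w hw hw01.1).trans (h 1 h1 one_ne_zero).symm)
    · have hy := h 0 h0 hx
      subst hy
      have h1x : 1 = x := by_contra fun h1x => one_ne_zero (h 1 h1 h1x)
      exact hw01.1 (h w hw (h1x ▸ hw01.2))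
  have hsub : ∀ x ∈ A, ∀ y ∈ A, x - y ∈ A := by
    intro x hx y hy
    obtain ⟨a, ha, hax, hay⟩ := hthird x y
    have := hrefl a ha x hx hax _ (hrefl a ha y hy hay 0 h0)
    rwa [sub_zero, add_sub_add_left_eq_sub] at this
  let B : AddSubgroup F := AddSubgroup.ofSub A ⟨0, h0⟩ fun x hx y hy => by
    simpa [sub_eq_add_neg] using hsub x hx y hy
  refine Or.inr ⟨B.multipliers, hH.multipliers_eq B h1 fun a σ h x hx hx0 hax z => ?_⟩
  simpa using! hA a σ h 0 x hx 0 h0 hx0 (by simpa using! hax) (by simpa using h0) z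

end SemilinearAction

section PartialLinearSpace

variable {V : Type*}

theorem PLS.apply_mem_iff_of_mem_aut {S : PLS V} {g : Equiv.Perm V} (hg : g ∈ S.aut) {L : Set V}
    (hL : L ∈ S.lines) {x y : V} (hx : x ∈ L) (hy : y ∈ L) (hxy : x ≠ y) (hgx : g x ∈ L)
    (hgy : g y ∈ L) (z : V) : g z ∈ L ↔ z ∈ L := by
  have hgL : g • L ∈ S.lines := by
    have := Set.smul_mem_smul_set (a := g) hL
    rwa [MulAction.mem_stabilizer_iff.1 hg] at this
  have heq : g • L = L := S.unique_of_pair _ hgL _ hL (g x) (g y) (g.injective.ne hxy)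
    (Set.smul_mem_smul_set hx) (Set.smul_mem_smul_set hy) hgx hgy
  conv_lhs => rw [← heq]
  exact Set.smul_mem_smul_set_iff (a := g)

variable {F : Type*} [Field F] [AddCommGroup V] [Module F V]

/-- The relation recording the semilinear maps `x ↦ a * σ x` induced on the line spanned by `u` by
the zero stabiliser of `G`. -/
def spanAction (F : Type*) [Field F] [Module F V] (G : Subgroup (Equiv.Perm V)) (u : V) (a : F)
    (σ : RingAut F) : Prop :=
  ∃ g ∈ G, g 0 = 0 ∧ ∀ c : F, g (c • u) = (a * σ c) • u

theorem isTransitiveSemilinear_spanAction {G : Subgroup (Equiv.Perm V)}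
    (hsemi : ∀ g ∈ G, g 0 = 0 →
      ∃ σ : F ≃+* F, ∀ (c : F) (v : V), g (c • v) = σ c • g v)
    {u : V} (hu0 : u ≠ 0)
    (hspan : (Submodule.span F ({u} : Set V) : Set V) \ {0} ⊆ zeroStabOrbit G u) :
    IsTransitiveSemilinear (spanAction F G u) where
  ne_zero := by
    rintro _ σ ⟨g, -, hg0, hg⟩ rfl
    have := hg 1
    rw [zero_mul, zero_smul, ← hg0, one_smul] at this
    exact hu0 (g.injective this)
  one := ⟨1, one_mem _, rfl, fun c => by simp⟩
  mul := by
    rintro a b σ τ ⟨g, hgG, hg0, hg⟩ ⟨h, hhG, hh0, hh⟩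
    refine ⟨g * h, mul_mem hgG hhG, by simp [hg0, hh0], fun c => ?_⟩
    rw [Equiv.Perm.mul_apply, hh, hg, map_mul, mul_assoc, RingAut.mul_apply]
  inv := by
    rintro a σ ⟨g, hgG, hg0, hg⟩
    have ha : a ≠ 0 := by
      rintro rfl
      have := hg 1
      rw [zero_mul, zero_smul, ← hg0, one_smul] at this
      exact hu0 (g.injective this)
    refine ⟨g⁻¹, inv_mem hgG, by rw [Equiv.Perm.inv_eq_iff_eq, hg0], fun c => ?_⟩
    rw [Equiv.Perm.inv_eq_iff_eq, hg, map_mul, RingAut.inv_apply, RingAut.inv_apply,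
      RingEquiv.apply_symm_apply, RingEquiv.apply_symm_apply, mul_inv_cancel_left₀ ha]
  exists_rel := by
    intro a ha
    obtain ⟨g, hgG, hg0, hgu⟩ := hspan ⟨Submodule.smul_mem _ a (Submodule.mem_span_singleton_self u),
      smul_ne_zero ha hu0⟩
    obtain ⟨σ, hσ⟩ := hsemi g hgG hg0
    exact ⟨σ, g, hgG, hg0, fun c => by rw [hσ, hgu, smul_smul, mul_comm]⟩

end PartialLinearSpace

/-- **Lemma 4.1.** Let `S = (V, 𝓛)` be a `G`-affine partial linear space on `V = V_n(q)`
with `G₀ ≤ ΓL_n(q)`, let `L` be a line through `0` and let `u ∈ L \ {0}`.  If all nonzero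
`F_q`-multiples of `u` lie in the `G₀`-orbit of `u`, then `{λ : F_q | λ • u ∈ L}` is
`{0, 1}` or a subfield of `F_q`. -/
theorem scalar_set_subfield
    {n : ℕ} (hn : 1 ≤ n)
    (F : Type*) [Field F] [Fintype F]
    (V : Type*) [AddCommGroup V] [Module F V] [Finite V]
    (hdim : Module.finrank F V = n)
    (S : PLS V)
    (G : Subgroup (Equiv.Perm V)) (hG : G ≤ S.aut)
    (haff : IsAffinePermGroup G)
    (hsemi : ∀ g ∈ G, g 0 = 0 →
      ∃ σ : F ≃+* F, ∀ (c : F) (v : V), g (c • v) = σ c • g v)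
    (L : Set V) (hL : L ∈ S.lines) (h0 : (0 : V) ∈ L)
    (u : V) (hu : u ∈ L) (hu0 : u ≠ 0)
    (hspan : (Submodule.span F ({u} : Set V) : Set V) \ {0} ⊆ zeroStabOrbit G u) :
    {c : F | c • u ∈ L} = {0, 1} ∨ ∃ K : Subfield F, {c : F | c • u ∈ L} = (K : Set F) := by
  have : Finite F := inferInstance
  refine (isTransitiveSemilinear_spanAction hsemi hu0 hspan).eq_pair_or_exists_subfield _
    (by simpa using h0) (by simpa using hu) ?_
  rintro a σ ⟨g, hgG, -, hg⟩ t x hx y hy hxy hax hay z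
  have hmem : Equiv.addRight (t • u) * g ∈ S.aut := hG (mul_mem (haff.1 _) hgG)
  have happly : ∀ c : F, (Equiv.addRight (t • u) * g) (c • u) = (a * σ c + t) • u := fun c => by
    rw [Equiv.Perm.mul_apply, hg, Equiv.coe_addRight, add_smul]
  have := PLS.apply_mem_iff_of_mem_aut hmem hL hx hy
    (fun h => hxy (smul_left_injective F hu0 h)) ((happly x).symm ▸ hax)
    ((happly y).symm ▸ hay) (z • u)
  rwa [happly] at this
end

section
/- Let V = V_n(q) with n ≥ 2 and q a prime power, and let G be an affine permutation group of rank 3 on V with G_0 ≤ ΓL_n(q) and ⟨x⟩ \ {0} ⊆ x^{G_0} for some x ∈ V \ {0}. Let (V, 𝓛) be an F_q-dependent G-affine proper partial linear space. Then there exist a subfield F of F_q with |F| > 2 and an orbit X of G_0 on V \ {0} such that 𝓛 = {⟨u⟩_F + v : u ∈ X, v ∈ V}, where ⟨u⟩_F denotes the F-span of u. -/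
open scoped Pointwise

theorem even_and_mod_four_of_primes_dvd {k M : ℕ} (hk : 2 ≤ k) (hM : 2 ≤ M)
    (h : ∀ r : ℕ, r.Prime → r ∣ k ^ M - 1 → r ∣ k - 1) : Even M ∧ k % 4 = 3 := by
  have hkM : k ^ 2 ≤ k ^ M := Nat.pow_le_pow_right (by omega) hM
  rcases Nat.even_or_odd M with hev | hodd
  · refine ⟨hev, ?_⟩
    have hdvd : k + 1 ∣ k ^ M - 1 := by
      obtain ⟨m, rfl⟩ := hev.two_dvd
      have : k ^ 2 - 1 ∣ (k ^ 2) ^ m - 1 ^ m := Nat.sub_dvd_pow_sub_pow _ _ _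
      rw [← pow_mul, one_pow] at this
      refine dvd_trans ⟨k - 1, ?_⟩ this
      simpa using Nat.sq_sub_sq k 1
    have hp2 : ∀ r : ℕ, r.Prime → r ∣ k + 1 → r = 2 := by
      intro r hr hrk
      have h1 := h r hr (hrk.trans hdvd)
      have h2 : r ∣ 2 := by
        have := Nat.dvd_sub hrk h1
        rwa [show k + 1 - (k - 1) = 2 by omega] at this
      exact (Nat.prime_dvd_prime_iff_eq hr Nat.prime_two).1 h2
    have := Nat.eq_prime_pow_of_unique_prime_dvd (n := k + 1) (p := 2) (by omega)
      (fun {d} hd hdk => hp2 d hd hdk)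
    set a := (k + 1).primeFactorsList.length
    have ha : 2 ≤ a := by
      by_contra hlt
      interval_cases a <;> omega
    obtain ⟨b, hb⟩ := Nat.exists_eq_add_of_le ha
    rw [hb, pow_add] at this
    omega
  · exfalso
    set N := (k ^ M - 1) / (k - 1) with hN
    have hd : k - 1 ∣ k ^ M - 1 := by simpa using Nat.sub_dvd_pow_sub_pow k 1 M
    have hNe : N * (k - 1) = k ^ M - 1 := Nat.div_mul_cancel hd
    have hN0 : N ≠ 0 := by
      rintro h0
      rw [h0, zero_mul] at hNe
      have : 2 ^ 2 ≤ k ^ 2 := Nat.pow_le_pow_left hk 2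
      omega
    have hsum : N = ∑ i ∈ Finset.range M, k ^ i := by
      rw [Nat.geomSum_eq hk]
    have hNM : M < N := by
      rw [hsum]
      calc M = ∑ i ∈ Finset.range M, 1 := by simp
        _ < _ := Finset.sum_lt_sum (fun i _ => Nat.one_le_pow _ _ (by omega))
          ⟨1, by simp; omega, by simpa using Nat.lt_of_succ_le hk⟩
    have hNdvd : N ∣ M := by
      rw [← Nat.factorization_prime_le_iff_dvd hN0 (by omega)]
      intro r hr
      by_cases hrN : r ∣ N
      · have hr1 : r ∣ k - 1 := h r hr (hrN.trans ⟨_, hNe.symm⟩)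
        have hrk : ¬ r ∣ k := by
          intro hrk
          have := Nat.dvd_sub hrk hr1
          rw [show k - (k - 1) = 1 by omega] at this
          exact hr.one_lt.ne' (Nat.dvd_one.1 this)
        have hro : Odd r := by
          rcases hr.eq_two_or_odd' with rfl | ho
          · exfalso
            have hko : Odd k := by
              rw [← Nat.not_even_iff_odd, even_iff_two_dvd]; exact hrk
            have : Odd N := by
              rw [hsum, Finset.odd_sum_iff_odd_card_odd]
              simpa [hko.pow] using hodd
            exact (Nat.not_even_iff_odd.2 this) (even_iff_two_dvd.2 hrN)
          · exact ho
        have : Fact r.Prime := ⟨hr⟩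
        have := padicValNat.pow_sub_pow (p := r) (x := k) (y := 1) hro (by omega) hr1 hrk
          (n := M) (by omega)
        rw [one_pow, ← hNe, padicValNat.mul hN0 (by omega)] at this
        rw [Nat.factorization_def _ hr, Nat.factorization_def _ hr]
        omega
      · rw [Nat.factorization_eq_zero_of_not_dvd hrN]; exact Nat.zero_le _
    exact absurd (Nat.le_of_dvd (by omega) hNdvd) (by omega)

theorem two_dvd_of_dvd_mul {p d m : ℕ} (hp : 1 < p) (hodd : Odd p) (hd : d ≠ 0)
    (h : p ^ d - 1 ∣ m * d) : 2 ∣ m ∧ (Even d → 4 ∣ m) := by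
  rcases eq_or_ne m 0 with rfl | hm
  · simp
  have : Fact (Nat.Prime 2) := ⟨Nat.prime_two⟩
  have hpd : p ^ 1 ≤ p ^ d := Nat.pow_le_pow_right (by omega) (by omega)
  rw [pow_one] at hpd
  have hpd0 : p ^ d - 1 ≠ 0 := by omega
  have hle : padicValNat 2 (p ^ d - 1) ≤ padicValNat 2 m + padicValNat 2 d := by
    rw [← padicValNat.mul hm hd]
    exact (padicValNat_dvd_iff_le (mul_ne_zero hm hd)).1
      (pow_padicValNat_dvd.trans h)
  have h2p : ¬ 2 ∣ p := by rwa [← even_iff_two_dvd, Nat.not_even_iff_odd]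
  rcases Nat.even_or_odd d with hev | hdo
  · have key := padicValNat.pow_two_sub_pow (x := p) (y := 1) (by omega)
      (by obtain ⟨c, rfl⟩ := hodd; exact ⟨c, by omega⟩) h2p hd hev
    rw [one_pow, ← padicValNat.mul (by omega) (by omega)] at key
    have h8 : 3 ≤ padicValNat 2 ((p + 1) * (p - 1)) := by
      rw [← padicValNat_dvd_iff_le (mul_ne_zero (by omega) (by omega))]
      have := Nat.eight_dvd_sq_sub_one_of_odd hodd
      have e := Nat.sq_sub_sq p 1
      rw [one_pow] at e
      rw [← e]; exact this
    have h4 : 2 ^ 2 ∣ m := (padicValNat_dvd_iff_le hm).2 (by omega)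
    exact ⟨dvd_trans (by norm_num) h4, fun _ => h4⟩
  · refine ⟨?_, fun he => absurd he (Nat.not_even_iff_odd.2 hdo)⟩
    have h2d : 2 ∣ p ^ d - 1 := by
      obtain ⟨c, hc⟩ := (hodd.pow : Odd (p ^ d)); exact ⟨c, by omega⟩
    have : 2 ∣ m * d := h2d.trans h
    rcases (Nat.Prime.dvd_mul Nat.prime_two).1 this with h | h
    · exact h
    · exact absurd (even_iff_two_dvd.2 h) (Nat.not_even_iff_odd.2 hdo)

namespace SemilinearPerm

variable {F : Type*} [Field F]

/-- Every element of `H` has the form `t ↦ c * σ t` for a ring homomorphism `σ`. -/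
def IsSemilinear (H : Subgroup (Equiv.Perm F)) : Prop :=
  ∀ h ∈ H, ∃ σ : F →+* F, ∀ t, h t = h 1 * σ t

namespace IsSemilinear

variable {H : Subgroup (Equiv.Perm F)}

theorem map_zero (hs : IsSemilinear H) {h : Equiv.Perm F} (hh : h ∈ H) : h 0 = 0 := by
  obtain ⟨σ, hσ⟩ := hs h hh
  rw [hσ, _root_.map_zero, mul_zero]

theorem map_one_ne_zero (hs : IsSemilinear H) {h : Equiv.Perm F} (hh : h ∈ H) : h 1 ≠ 0 := by
  rw [← hs.map_zero hh]
  exact h.injective.ne one_ne_zero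

theorem map_add (hs : IsSemilinear H) {h : Equiv.Perm F} (hh : h ∈ H) (a b : F) :
    h (a + b) = h a + h b := by
  obtain ⟨σ, hσ⟩ := hs h hh
  rw [hσ, hσ a, hσ b, _root_.map_add, mul_add]

/-- The field automorphism part of a semilinear group, as a homomorphism. -/
theorem exists_hom [Finite F] (hs : IsSemilinear H) (p : ℕ) [Fact p.Prime] [Algebra (ZMod p) F] :
    ∃ π : H →* (F ≃ₐ[ZMod p] F), ∀ (h : H) (t : F), h.1 t = h.1 1 * π h t := by
  have key : ∀ h : H, ∃ σ : F ≃ₐ[ZMod p] F, ∀ t, h.1 t = h.1 1 * σ t := by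
    intro h
    obtain ⟨σ, hσ⟩ := hs h.1 h.2
    have hb : Function.Bijective σ := Finite.injective_iff_bijective.1 σ.injective
    refine ⟨AlgEquiv.ofRingEquiv (f := RingEquiv.ofBijective σ hb) fun c => ?_, hσ⟩
    exact DFunLike.congr_fun (Subsingleton.elim (σ.comp (algebraMap (ZMod p) F))
      (algebraMap (ZMod p) F)) c
  choose π hπ using key
  refine ⟨MonoidHom.mk' π fun a b => ?_, hπ⟩
  ext t
  have hne : (a * b).1 1 ≠ 0 := hs.map_one_ne_zero (a * b).2
  apply mul_left_cancel₀ hne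
  rw [← hπ (a * b) t]
  have e : ∀ t, (a * b).1 t = a.1 (b.1 t) := fun t => rfl
  rw [e, e, hπ b t, hπ a (b.1 1 * _), hπ a (b.1 1), _root_.map_mul, AlgEquiv.mul_apply, mul_assoc]

/-- A transitive semilinear group contains many scalars. -/
theorem card_sub_one_dvd [Finite F] (hs : IsSemilinear H) (ht : ∀ u : F, u ≠ 0 → ∃ h ∈ H, h 1 = u)
    {p : ℕ} [Fact p.Prime] [Algebra (ZMod p) F] (π : H →* (F ≃ₐ[ZMod p] F)) :
    Nat.card F - 1 ∣ Nat.card π.ker * Module.finrank (ZMod p) F := by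
  classical
  have h1 : Nat.card F - 1 ∣ Nat.card H := by
    have horb : MulAction.orbit H (1 : F) = {0}ᶜ := by
      ext u
      constructor
      · rintro ⟨h, rfl⟩
        exact hs.map_one_ne_zero h.2
      · intro hu
        obtain ⟨h, hh, rfl⟩ := ht u hu
        exact ⟨⟨h, hh⟩, rfl⟩
    have e := Nat.card_congr (MulAction.orbitProdStabilizerEquivGroup H (1 : F))
    rw [Nat.card_prod, horb, Nat.card_coe_set_eq, Set.ncard_compl, Set.ncard_singleton] at e
    exact ⟨_, e.symm⟩
  have h2 : Nat.card H = Nat.card π.ker * Nat.card π.range := by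
    rw [← Subgroup.index_ker, Subgroup.card_mul_index]
  have h3 : Nat.card π.range ∣ Module.finrank (ZMod p) F := by
    rw [← IsGalois.card_aut_eq_finrank]
    exact Subgroup.card_subgroup_dvd_card _
  exact h1.trans (h2 ▸ mul_dvd_mul_left _ h3)

/-- An element of prime order of a group acting regularly on the nonzero elements of `F`
is a scalar. -/
theorem hom_eq_one_of_pow_eq_one (hs : IsSemilinear H)
    (ht : ∀ u : F, u ≠ 0 → ∃ h ∈ H, h 1 = u) (hreg : ∀ h ∈ H, h 1 = 1 → h = 1)
    {p : ℕ} [Fact p.Prime] [Algebra (ZMod p) F] {π : H →* (F ≃ₐ[ZMod p] F)}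
    (hπ : ∀ (h : H) (t : F), h.1 t = h.1 1 * π h t) {r : ℕ} (hr : r.Prime) {y : H}
    (hy : y ^ r = 1) : π y = 1 := by
  by_contra hne
  have : Fact r.Prime := ⟨hr⟩
  have hord : orderOf (π y) = r := orderOf_eq_prime (by rw [← map_pow, hy, map_one]) hne
  have hex : ∃ t : F, ∑ i ∈ Finset.range r, (y ^ i).1 t ≠ 0 := by
    by_contra! hall
    have hli : LinearIndependent F (fun i : Fin r => (⇑((π (y ^ (i : ℕ))) : F →* F) : F → F)) := by
      refine (linearIndependent_monoidHom F F).comp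
        (fun i : Fin r => ((π (y ^ (i : ℕ)) : F ≃ₐ[ZMod p] F) : F →* F)) ?_
      intro i j hij
      have : π y ^ (i : ℕ) = π y ^ (j : ℕ) := by
        rw [← map_pow, ← map_pow]
        ext t
        exact DFunLike.congr_fun hij t
      exact Fin.ext (pow_injOn_Iio_orderOf (by simp [hord]) (by simp [hord]) this)
    rw [Fintype.linearIndependent_iff] at hli
    have := hli (fun i => (y ^ (i : ℕ)).1 1) (by
      funext t
      have h0 := hall t
      rw [Finset.sum_range] at h0
      simp only [Finset.sum_apply, Pi.smul_apply, smul_eq_mul, Pi.zero_apply]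
      rw [← h0]
      exact Finset.sum_congr rfl fun i _ => (hπ _ t).symm) ⟨0, hr.pos⟩
    simp at this
  obtain ⟨t, hu⟩ := hex
  set u := ∑ i ∈ Finset.range r, (y ^ i).1 t with hudef
  have hyu : y.1 u = u := by
    have hsum : y.1 u = ∑ i ∈ Finset.range r, y.1 ((y ^ i).1 t) := by
      rw [hudef]
      let f : F →+ F := ⟨⟨y.1, hs.map_zero y.2⟩, hs.map_add y.2⟩
      exact map_sum f _ _
    have hstep : ∀ i, y.1 ((y ^ i).1 t) = (y ^ (i + 1)).1 t := fun i => by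
      rw [pow_succ']; rfl
    rw [hsum, Finset.sum_congr rfl fun i _ => hstep i, hudef]
    have a := Finset.sum_range_succ (fun i => (y ^ i).1 t) r
    rw [Finset.sum_range_succ', hy, pow_zero] at a
    exact add_right_cancel a
  obtain ⟨h, hh, hhu⟩ := ht u hu
  have hc := hreg (h⁻¹ * y.1 * h) (H.mul_mem (H.mul_mem (H.inv_mem hh) y.2) hh) (by
    rw [Equiv.Perm.mul_apply, Equiv.Perm.mul_apply, hhu, hyu, ← hhu]
    exact h.symm_apply_apply 1)
  have hy1 : y = 1 := by
    ext1
    have : y.1 = h * (h⁻¹ * y.1 * h) * h⁻¹ := by group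
    rw [this, hc]; simp
  exact hne (by rw [hy1, map_one])

theorem scalar_apply {p : ℕ} [Fact p.Prime] [Algebra (ZMod p) F] {π : H →* (F ≃ₐ[ZMod p] F)}
    (hπ : ∀ (h : H) (t : F), h.1 t = h.1 1 * π h t) {h : H} (hh : π h = 1) (t : F) :
    h.1 t = h.1 1 * t := by
  rw [hπ, hh, AlgEquiv.one_apply]

/-- The scalars in a semilinear group embed in the multiplicative group. -/
theorem exists_ker_hom (hs : IsSemilinear H) {p : ℕ} [Fact p.Prime] [Algebra (ZMod p) F]
    {π : H →* (F ≃ₐ[ZMod p] F)} (hπ : ∀ (h : H) (t : F), h.1 t = h.1 1 * π h t) :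
    ∃ ψ : π.ker →* Fˣ, Function.Injective ψ ∧ ∀ h, (ψ h : F) = h.1.1 1 := by
  refine ⟨MonoidHom.mk' (fun h => Units.mk0 (h.1.1 1) (hs.map_one_ne_zero h.1.2)) ?_, ?_, ?_⟩
  · intro a b
    ext
    exact scalar_apply hπ a.2 (b.1.1 1)
  · intro a b hab
    have h1 : a.1.1 1 = b.1.1 1 := congrArg Units.val hab
    apply Subtype.ext
    apply Subtype.ext
    ext t
    rw [scalar_apply hπ a.2, scalar_apply hπ b.2, h1]
  · intro h
    rfl

end IsSemilinear

/-- The subfield of all scalars preserving an additive subgroup of a finite field. -/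
def multiplierSubfield [Finite F] (L : AddSubgroup F) : Subfield F where
  carrier := {c | ∀ t ∈ L, c * t ∈ L}
  mul_mem' {a b} ha hb t ht := by rw [mul_assoc]; exact ha _ (hb t ht)
  one_mem' t ht := by rwa [one_mul]
  add_mem' {a b} ha hb t ht := by rw [add_mul]; exact L.add_mem (ha t ht) (hb t ht)
  zero_mem' t _ := by rw [zero_mul]; exact L.zero_mem
  neg_mem' {a} ha t ht := by rw [neg_mul]; exact L.neg_mem (ha t ht)
  inv_mem' a ha := by
    rcases eq_or_ne a 0 with rfl | h0
    · rwa [inv_zero]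
    have hpow : ∀ n : ℕ, ∀ t ∈ L, a ^ n * t ∈ L := by
      intro n
      induction n with
      | zero => simp
      | succ n ih => intro t ht; rw [pow_succ, mul_assoc]; exact ih _ (ha t ht)
    have : a⁻¹ = a ^ (orderOf a - 1) := by
      have hpos : 0 < orderOf a := by
        rw [← Units.val_mk0 h0, orderOf_units]; exact orderOf_pos _
      apply inv_eq_of_mul_eq_one_right
      rw [← pow_succ', Nat.sub_add_cancel hpos, pow_orderOf_eq_one]
    rw [this]
    exact hpow _

theorem mem_multiplierSubfield [Finite F] {L : AddSubgroup F} {c : F} :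
    c ∈ multiplierSubfield L ↔ ∀ t ∈ L, c * t ∈ L := Iff.rfl

theorem card_eq_pow_of_not_le [Finite F] {L : AddSubgroup F} (h1 : (1 : F) ∈ L)
    {v : F} (hv : v ∈ L) (hvK : v ∉ multiplierSubfield L) :
    ∃ M, 2 ≤ M ∧ Nat.card L = Nat.card (multiplierSubfield L) ^ M := by
  let W : Submodule (multiplierSubfield L) F :=
    { L with smul_mem' := fun c t ht => c.2 t ht }
  have hcard : Nat.card L = Nat.card (multiplierSubfield L) ^
      Module.finrank (multiplierSubfield L) W :=
    Module.natCard_eq_pow_finrank (K := multiplierSubfield L) (V := W)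
  refine ⟨_, ?_, hcard⟩
  have hlt : Nat.card (multiplierSubfield L) < Nat.card L := by
    change Nat.card (multiplierSubfield L : Set F) < Nat.card (L : Set F)
    rw [Nat.card_coe_set_eq, Nat.card_coe_set_eq]
    refine Set.ncard_lt_ncard ⟨fun c hc => ?_, fun h => hvK (h hv)⟩ (Set.toFinite _)
    simpa using hc 1 h1
  by_contra hM
  have hle : Nat.card L ≤ Nat.card (multiplierSubfield L) ^ 1 := by
    rw [hcard]
    exact Nat.pow_le_pow_right Nat.card_pos (by omega)
  rw [pow_one] at hle
  omega

namespace IsSemilinear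

variable {H : Subgroup (Equiv.Perm F)}

/-- The setwise stabiliser of `L` in `H`. -/
def setStab (H : Subgroup (Equiv.Perm F)) (L : AddSubgroup F) : Subgroup H where
  carrier := {h | ∀ t, h.1 t ∈ L ↔ t ∈ L}
  mul_mem' {a b} ha hb t := (ha (b.1 t)).trans (hb t)
  one_mem' t := Iff.rfl
  inv_mem' {a} ha t := by
    have := ha (a.1.symm t)
    rw [Equiv.apply_symm_apply] at this
    exact this.symm

theorem mem_setStab [Finite F] {L : AddSubgroup F} (h1 : (1 : F) ∈ L)
    (hL : ∀ h ∈ H, h 1 ∈ L → ∀ t ∈ L, h t ∈ L) {h : H} : h ∈ setStab H L ↔ h.1 1 ∈ L := by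
  refine ⟨fun hh => (hh 1).2 h1, fun hh t => ⟨fun ht => ?_, hL h.1 h.2 hh t⟩⟩
  have himg : h.1 '' (L : Set F) = L := by
    refine Set.eq_of_subset_of_ncard_le ?_ ?_ (Set.toFinite _)
    · rintro _ ⟨s, hs, rfl⟩
      exact hL h.1 h.2 hh s hs
    · rw [Set.ncard_image_of_injective _ h.1.injective]
  have : h.1 t ∈ h.1 '' (L : Set F) := by rw [himg]; exact ht
  obtain ⟨s, hs, hst⟩ := this
  rwa [← h.1.injective hst]

theorem mul_mem_of_regular [Finite F] (hs : IsSemilinear H)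
    (ht : ∀ u : F, u ≠ 0 → ∃ h ∈ H, h 1 = u) (hreg : ∀ h ∈ H, h 1 = 1 → h = 1)
    {L : AddSubgroup F} (h1 : (1 : F) ∈ L) (hL : ∀ h ∈ H, h 1 ∈ L → ∀ t ∈ L, h t ∈ L)
    {v : F} (hv : v ∈ L) : v ∈ multiplierSubfield L := by
  classical
  by_contra hvK
  obtain ⟨p, _⟩ := CharP.exists F
  have hp : p.Prime := CharP.char_is_prime F p
  have : Fact p.Prime := ⟨hp⟩
  let _ := ZMod.algebra F p
  obtain ⟨π, hπ⟩ := hs.exists_hom p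
  obtain ⟨M, hM, hLcard⟩ := card_eq_pow_of_not_le h1 hv hvK
  set K := multiplierSubfield L with hK
  set k := Nat.card K with hk
  have hk2 : 2 ≤ k := Finite.one_lt_card
  set J := setStab H L
  have hJ : ∀ {h : H}, h ∈ J ↔ h.1 1 ∈ L := mem_setStab h1 hL
  let πJ : J →* (F ≃ₐ[ZMod p] F) := π.comp J.subtype
  have hJcard : Nat.card J = k ^ M - 1 := by
    rw [← hLcard]
    let f : J → {t : F // t ∈ (L : Set F) \ {0}} := fun h =>
      ⟨h.1.1 1, hJ.1 h.2, hs.map_one_ne_zero h.1.2⟩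
    have hf : Function.Bijective f := by
      constructor
      · intro a b hab
        have hab : a.1.1 1 = b.1.1 1 := congrArg Subtype.val hab
        have := hreg (b.1.1⁻¹ * a.1.1) (H.mul_mem (H.inv_mem b.1.2) a.1.2)
          (by rw [Equiv.Perm.mul_apply, hab]; exact b.1.1.symm_apply_apply 1)
        exact Subtype.ext (Subtype.ext (inv_mul_eq_one.1 this).symm)
      · rintro ⟨u, huL, hu0⟩
        obtain ⟨h, hh, rfl⟩ := ht u hu0
        exact ⟨⟨⟨h, hh⟩, hJ.2 huL⟩, rfl⟩
    rw [Nat.card_congr (Equiv.ofBijective f hf)]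
    have := Set.ncard_sdiff_singleton_of_mem (L.zero_mem : (0 : F) ∈ (L : Set F))
    rw [← Nat.card_coe_set_eq, ← Nat.card_coe_set_eq] at this
    exact this
  have hker : Nat.card πJ.ker ∣ k - 1 := by
    have hmem : ∀ h : πJ.ker, h.1.1.1 1 ∈ K := fun h t htL => by
      rw [← scalar_apply hπ (h := h.1.1) h.2]
      exact (h.1.2 t).2 htL
    let ψ : πJ.ker →* Kˣ := MonoidHom.mk'
      (fun h => Units.mk0 ⟨h.1.1.1 1, hmem h⟩ fun h0 =>
        hs.map_one_ne_zero h.1.1.2 (congrArg Subtype.val h0)) (by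
        intro a b
        ext
        exact scalar_apply hπ (h := a.1.1) a.2 (b.1.1.1 1))
    have hψ : Function.Injective ψ := by
      intro a b hab
      have h1 : a.1.1.1 1 = b.1.1.1 1 := congrArg (fun x : Kˣ => ((x : K) : F)) hab
      apply Subtype.ext
      apply Subtype.ext
      apply Subtype.ext
      ext t
      rw [scalar_apply hπ (h := a.1.1) a.2, scalar_apply hπ (h := b.1.1) b.2, h1]
    have := Subgroup.card_dvd_of_injective ψ hψ
    rwa [Nat.card_units] at this
  have hprimes : ∀ r : ℕ, r.Prime → r ∣ k ^ M - 1 → r ∣ k - 1 := by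
    intro r hr hrd
    rw [← hJcard] at hrd
    have : Fact r.Prime := ⟨hr⟩
    obtain ⟨y, hy⟩ := exists_prime_orderOf_dvd_card' r hrd
    have hyr : y.1 ^ r = 1 := by
      rw [← hy]; exact congrArg Subtype.val (pow_orderOf_eq_one y)
    have hyk : y ∈ πJ.ker := hs.hom_eq_one_of_pow_eq_one ht hreg hπ hr hyr
    rw [← hy]
    exact (Subgroup.orderOf_dvd_natCard _ hyk).trans hker
  obtain ⟨hMe, hk4⟩ := even_and_mod_four_of_primes_dvd hk2 hM hprimes
  have hrange : 4 ∣ Nat.card πJ.range := by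
    have h8 : 8 ∣ Nat.card πJ.ker * Nat.card πJ.range := by
      rw [← Subgroup.index_ker, Subgroup.card_mul_index, hJcard]
      obtain ⟨m, rfl⟩ := hMe
      rw [← mul_two, pow_mul]
      exact Nat.eight_dvd_sq_sub_one_of_odd (Odd.pow (Nat.odd_iff.2 (by omega)))
    obtain ⟨c, hc⟩ := hker
    have h8' : 8 ∣ (k - 1) * Nat.card πJ.range := by
      rw [hc, mul_right_comm]; exact h8.mul_right c
    obtain ⟨m, hm⟩ : ∃ m, k = 4 * m + 3 := ⟨k / 4, by omega⟩
    have e : (k - 1) * Nat.card πJ.range = 2 * ((2 * m + 1) * Nat.card πJ.range) := by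
      rw [hm, show 4 * m + 3 - 1 = 2 * (2 * m + 1) by omega]; ring
    rw [e, show 8 = 2 * 4 from rfl] at h8'
    have h4 := Nat.dvd_of_mul_dvd_mul_left (by norm_num) h8'
    refine Nat.Coprime.dvd_of_dvd_mul_left ?_ h4
    have : Nat.Coprime (2 ^ 2) (2 * m + 1) := by
      apply Nat.Coprime.pow_left
      simp
    exact this
  have hd : Even (Module.finrank (ZMod p) F) := by
    rw [← IsGalois.card_aut_eq_finrank, even_iff_two_dvd]
    exact (dvd_trans (by norm_num) hrange).trans (Subgroup.card_subgroup_dvd_card _)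
  have hFcard : Nat.card F = p ^ Module.finrank (ZMod p) F := by
    have := Module.natCard_eq_pow_finrank (K := ZMod p) (V := F)
    rwa [Nat.card_zmod] at this
  have hpodd : Odd p := by
    have hF : Odd (Nat.card F) := by
      rw [Module.natCard_eq_pow_finrank (K := K) (V := F)]
      exact Odd.pow (Nat.odd_iff.2 (by omega))
    rw [hFcard] at hF
    rcases hp.eq_two_or_odd' with rfl | h
    · exact absurd hF (Nat.not_odd_iff_even.2
        (Nat.even_pow.2 ⟨even_two, Module.finrank_pos.ne'⟩))
    · exact h
  have h4 : 4 ∣ Nat.card π.ker := by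
    have := hs.card_sub_one_dvd ht π
    rw [hFcard] at this
    exact (two_dvd_of_dvd_mul hp.one_lt hpodd Module.finrank_pos.ne' this).2 hd
  obtain ⟨h, hh2⟩ : ∃ h : π.ker, (h.1.1 1) ^ 2 = -1 := by
    obtain ⟨ψ, hψ, hψ1⟩ := hs.exists_ker_hom hπ
    have : IsCyclic π.ker := isCyclic_of_injective ψ hψ
    obtain ⟨g, hg⟩ := IsCyclic.exists_ofOrder_eq_natCard (α := π.ker)
    obtain ⟨c, hc⟩ := h4
    have hc0 : c ≠ 0 := by rintro rfl; exact Nat.card_pos.ne' hc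
    refine ⟨g ^ c, ?_⟩
    have hord : orderOf (g ^ c) = 4 := by
      rw [orderOf_pow_of_dvd hc0 (by rw [hg, hc]; exact dvd_mul_left _ _), hg, hc,
        Nat.mul_div_cancel _ (Nat.pos_of_ne_zero hc0)]
    rw [← orderOf_injective ψ hψ, ← orderOf_units, hψ1] at hord
    set x : F := (g ^ c).1.1 1
    have hx4 : (x ^ 2 - 1) * (x ^ 2 + 1) = 0 := by
      have := pow_orderOf_eq_one x
      rw [hord] at this
      linear_combination this
    rcases mul_eq_zero.1 hx4 with h | h
    · have := orderOf_dvd_of_pow_eq_one (sub_eq_zero.1 h)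
      rw [hord] at this
      norm_num at this
    · exact eq_neg_of_add_eq_zero_left h
  obtain ⟨ρ, hρJ, hρ⟩ : ∃ ρ ∈ πJ.range, orderOf ρ = 4 := by
    obtain ⟨g, hg⟩ := IsCyclic.exists_ofOrder_eq_natCard (α := πJ.range)
    obtain ⟨c, hc⟩ := hrange
    have hc0 : c ≠ 0 := by rintro rfl; exact Nat.card_pos.ne' hc
    refine ⟨(g ^ c).1, (g ^ c).2, ?_⟩
    rw [Subgroup.orderOf_coe, orderOf_pow_of_dvd hc0 (by rw [hg, hc]; exact dvd_mul_left _ _),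
      hg, hc, Nat.mul_div_cancel _ (Nat.pos_of_ne_zero hc0)]
  obtain ⟨y₀, hy₀⟩ := hρJ
  obtain ⟨n, hn, hnodd⟩ : ∃ n, k - 1 = 2 * n ∧ n % 2 = 1 := ⟨(k - 1) / 2, by omega, by omega⟩
  have hz : y₀ ^ 4 ∈ πJ.ker := by
    rw [MonoidHom.mem_ker, map_pow, hy₀, ← hρ, pow_orderOf_eq_one]
  set y : J := y₀ ^ (2 * n) with hy
  have hπy : π y.1 = ρ ^ (2 * n) := by
    rw [← hy₀]; exact map_pow πJ y₀ _
  have hπy1 : π y.1 ≠ 1 := by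
    rw [hπy, Ne, ← orderOf_dvd_iff_pow_eq_one, hρ]
    omega
  have hy2 : y ^ 2 = (y₀ ^ 4) ^ n := by
    rw [hy, ← pow_mul, ← pow_mul]; congr 1; ring
  have hy2ker : y ^ 2 ∈ πJ.ker := hy2 ▸ Subgroup.pow_mem _ hz n
  have hy4 : (y ^ 2) ^ 2 = 1 := by
    rw [hy2, ← pow_mul, mul_comm n 2, ← hn]
    exact orderOf_dvd_iff_pow_eq_one.1 ((Subgroup.orderOf_dvd_natCard _ hz).trans hker)
  have hw1 : y.1.1 (y.1.1 1) = -1 := by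
    have e : ((y ^ 2) ^ 2).1.1 1 = (y ^ 2).1.1 ((y ^ 2).1.1 1) := by rw [sq (y ^ 2)]; rfl
    have e' : (y ^ 2).1.1 1 = y.1.1 (y.1.1 1) := by rw [sq y]; rfl
    have hs2 : π (y ^ 2).1 = 1 := hy2ker
    rw [hy4, scalar_apply hπ hs2 ((y ^ 2).1.1 1), e'] at e
    rcases mul_self_eq_one_iff.1 e.symm with h | h
    · exfalso
      have := hreg (y ^ 2).1.1 (y ^ 2).1.2 (e'.trans h)
      exact hπy1 (hs.hom_eq_one_of_pow_eq_one ht hreg hπ Nat.prime_two (Subtype.ext this))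
    · exact h
  set c : F := h.1.1 1 with hc
  have hfix : π y.1 c = c := by
    rw [hπy, mul_comm, pow_mul, sq, AlgEquiv.mul_apply]
    have hsq : ((ρ ^ n) c) ^ 2 = c ^ 2 := by rw [← map_pow, hh2, map_neg, map_one]
    rcases sq_eq_sq_iff_eq_or_eq_neg.1 hsq with h | h
    · rw [h, h]
    · rw [h, map_neg, h, neg_neg]
  have hprod : (h.1 * y.1) ^ 2 = 1 := by
    apply Subtype.ext
    refine hreg _ (Subtype.property _) ?_
    have e : ((h.1 * y.1) ^ 2).1 1 = h.1.1 (y.1.1 (h.1.1 (y.1.1 1))) := by rw [sq]; rfl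
    rw [e, scalar_apply hπ h.2, scalar_apply hπ h.2 (y.1.1 1), hπ y.1 (_ * _), map_mul, ← hc,
      hfix, mul_left_comm (y.1.1 1), ← hπ, hw1, ← mul_assoc, ← sq, hh2, neg_mul_neg, one_mul]
  have := hs.hom_eq_one_of_pow_eq_one ht hreg hπ Nat.prime_two hprod
  rw [map_mul, h.2, one_mul] at this
  exact hπy1 this

/-- If `L` is not contained in its multiplier field, then the stabiliser of `1` fixes `L`
pointwise. -/
theorem apply_eq_of_map_one [Finite F] (hs : IsSemilinear H)
    (ht : ∀ u : F, u ≠ 0 → ∃ h ∈ H, h 1 = u)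
    {L : AddSubgroup F} (h1 : (1 : F) ∈ L) (hL : ∀ h ∈ H, h 1 ∈ L → ∀ t ∈ L, h t ∈ L)
    {v : F} (hv : v ∈ L) (hvK : v ∉ multiplierSubfield L) {a : Equiv.Perm F} (ha : a ∈ H)
    (ha1 : a 1 = 1) {t : F} (htL : t ∈ L) : a t = t := by
  obtain ⟨p, _⟩ := CharP.exists F
  have : Fact p.Prime := ⟨CharP.char_is_prime F p⟩
  let _ := ZMod.algebra F p
  obtain ⟨π, hπ⟩ := hs.exists_hom p
  have hscalar : ∀ t ∈ L, ∃ z ∈ multiplierSubfield L, a t = z * t := by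
    intro t htL
    rcases eq_or_ne t 0 with rfl | ht0
    · exact ⟨1, one_mem _, by rw [hs.map_zero ha, mul_zero]⟩
    obtain ⟨g, hg, rfl⟩ := ht t ht0
    let a' : H := ⟨a, ha⟩
    let g' : H := ⟨g, hg⟩
    have ha' : a' ∈ setStab H L := (mem_setStab h1 hL).2 (by rwa [← ha1] at h1)
    have hg' : g' ∈ setStab H L := (mem_setStab h1 hL).2 htL
    have hm : a' * g' * a'⁻¹ * g'⁻¹ ∈ setStab H L :=
      mul_mem (mul_mem (mul_mem ha' hg') (inv_mem ha')) (inv_mem hg')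
    have hπm : π (a' * g' * a'⁻¹ * g'⁻¹) = 1 := by
      simp only [map_mul, map_inv]
      have := IsCyclic.isMulCommutative.is_comm.comm (π a') (π g')
      rw [this]
      group
    refine ⟨(a' * g' * a'⁻¹ * g'⁻¹).1 1, fun s hsL => ?_, ?_⟩
    · rw [← scalar_apply hπ hπm]
      exact (hm s).2 hsL
    · rw [← scalar_apply hπ hπm]
      have e : (a' * g' * a'⁻¹ * g'⁻¹).1 (g 1) = a (g (a.symm (g.symm (g 1)))) := rfl
      rw [e, Equiv.symm_apply_apply, (Equiv.symm_apply_eq a).2 ha1.symm]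
  have houter : ∀ w ∈ L, w ∉ multiplierSubfield L → a w = w := by
    intro w hw hwK
    obtain ⟨z, hz, hzw⟩ := hscalar w hw
    obtain ⟨z', hz', hzw'⟩ := hscalar (1 + w) (L.add_mem h1 hw)
    rw [hs.map_add ha, ha1, hzw] at hzw'
    have hlin : z' - 1 = (z - z') * w := by linear_combination -hzw'
    by_cases hzz : z - z' = 0
    · rw [hzz, zero_mul, sub_eq_zero] at hlin
      rw [hzw, sub_eq_zero.1 hzz, hlin, one_mul]
    · refine absurd ?_ hwK
      rw [eq_div_of_mul_eq hzz ((mul_comm _ _).trans hlin.symm)]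
      exact div_mem (sub_mem hz' (one_mem _)) (sub_mem hz hz')
  by_cases htK : t ∈ multiplierSubfield L
  · have := houter (t + v) (L.add_mem htL hv) fun h => hvK ((add_mem_cancel_left htK).1 h)
    rw [hs.map_add ha, houter v hv hvK] at this
    exact add_right_cancel this
  · exact houter t htL htK

/-- The common fixed field of the stabiliser of `1` in a semilinear group. -/
def fixedSubfield (hs : IsSemilinear H) : Subfield F where
  carrier := {t | ∀ a ∈ H, a 1 = 1 → a t = t}
  mul_mem' {s t} hs' ht' a ha ha1 := by
    obtain ⟨σ, hσ⟩ := hs a ha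
    simp only [ha1, one_mul] at hσ
    rw [hσ, map_mul, ← hσ, ← hσ, hs' a ha ha1, ht' a ha ha1]
  one_mem' a _ ha1 := ha1
  add_mem' {s t} hs' ht' a ha ha1 := by rw [hs.map_add ha, hs' a ha ha1, ht' a ha ha1]
  zero_mem' a ha _ := hs.map_zero ha
  neg_mem' {s} hs' a ha ha1 := by
    obtain ⟨σ, hσ⟩ := hs a ha
    rw [hσ, map_neg, mul_neg, ← hσ, hs' a ha ha1]
  inv_mem' s hs' a ha ha1 := by
    obtain ⟨σ, hσ⟩ := hs a ha
    simp only [ha1, one_mul] at hσ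
    rw [hσ, map_inv₀, ← hσ, hs' a ha ha1]

/-- The permutations of a subfield induced by elements of `H`. -/
def restrict (H : Subgroup (Equiv.Perm F)) (E : Subfield F) : Subgroup (Equiv.Perm E) where
  carrier := {h' | ∃ h ∈ H, ∀ e : E, (h' e : F) = h e}
  mul_mem' := by
    rintro a b ⟨a', ha', ha⟩ ⟨b', hb', hb⟩
    exact ⟨a' * b', H.mul_mem ha' hb', fun e => by
      rw [Equiv.Perm.mul_apply, Equiv.Perm.mul_apply, ha, hb]⟩
  one_mem' := ⟨1, H.one_mem, fun _ => rfl⟩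
  inv_mem' := by
    rintro a ⟨a', ha', ha⟩
    refine ⟨a'⁻¹, H.inv_mem ha', fun e => ?_⟩
    change ((a.symm e : E) : F) = a'.symm e
    rw [Equiv.eq_symm_apply, ← ha, Equiv.apply_symm_apply]

theorem restrict_isSemilinear (hs : IsSemilinear H) (E : Subfield F) :
    IsSemilinear (restrict H E) := by
  rintro h' ⟨h, hh, he⟩
  obtain ⟨σ, hσ⟩ := hs h hh
  have h1 : (h' 1 : F) = h 1 := he 1
  have hE : ∀ x ∈ E, σ x ∈ E := by
    intro x hx
    have : σ x = (h' ⟨x, hx⟩ : F) / (h' 1 : F) := by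
      rw [h1, he, hσ x, mul_div_cancel_left₀ _ (hs.map_one_ne_zero hh)]
    rw [this]
    exact div_mem (h' _).2 (h' _).2
  refine ⟨σ.restrict E E hE, fun t => Subtype.ext ?_⟩
  rw [he, hσ, ← h1]
  rfl

theorem exists_restrict_fixedSubfield [Finite F] (hs : IsSemilinear H)
    (ht : ∀ u : F, u ≠ 0 → ∃ h ∈ H, h 1 = u) (u : hs.fixedSubfield) (hu : u ≠ 0) :
    ∃ h ∈ restrict H hs.fixedSubfield, h 1 = u := by
  obtain ⟨p, _⟩ := CharP.exists F
  have : Fact p.Prime := ⟨CharP.char_is_prime F p⟩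
  let _ := ZMod.algebra F p
  obtain ⟨π, hπ⟩ := hs.exists_hom p
  obtain ⟨h, hh, hhu⟩ := ht u fun h0 => hu (Subtype.ext h0)
  have hmaps : ∀ e ∈ hs.fixedSubfield, h e ∈ hs.fixedSubfield := by
    intro e he a ha ha1
    have hπa : ∀ t, a t = π ⟨a, ha⟩ t := fun t => by
      rw [hπ ⟨a, ha⟩ t, ha1, one_mul]
    have hcomm := IsCyclic.isMulCommutative.is_comm.comm (π ⟨a, ha⟩) (π ⟨h, hh⟩)
    rw [hπ ⟨h, hh⟩ e, hπa, map_mul, ← hπa, hhu, u.2 a ha ha1, ← AlgEquiv.mul_apply, hcomm,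
      AlgEquiv.mul_apply, ← hπa, he a ha ha1]
  let f : hs.fixedSubfield → hs.fixedSubfield := fun e => ⟨h e, hmaps e e.2⟩
  have hf : Function.Injective f := fun a b hab =>
    Subtype.ext (h.injective (congrArg Subtype.val hab))
  exact ⟨Equiv.ofBijective f (Finite.injective_iff_bijective.1 hf), ⟨h, hh, fun _ => rfl⟩,
    Subtype.ext hhu⟩

/-- A block of a transitive semilinear group that is an additive subgroup is a subfield. -/
theorem mem_multiplierSubfield_of_mem [Finite F] (hs : IsSemilinear H)
    (ht : ∀ u : F, u ≠ 0 → ∃ h ∈ H, h 1 = u) {L : AddSubgroup F} (h1 : (1 : F) ∈ L)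
    (hL : ∀ h ∈ H, h 1 ∈ L → ∀ t ∈ L, h t ∈ L) {v : F} (hv : v ∈ L) :
    v ∈ multiplierSubfield L := by
  by_contra hvK
  have hLE : ∀ t ∈ L, t ∈ hs.fixedSubfield := fun t htL a ha ha1 =>
    hs.apply_eq_of_map_one ht h1 hL hv hvK ha ha1 htL
  refine hvK fun t htL => ?_
  refine (hs.restrict_isSemilinear hs.fixedSubfield).mul_mem_of_regular
    (hs.exists_restrict_fixedSubfield ht) ?_
    (L := L.comap (hs.fixedSubfield.subtype : hs.fixedSubfield →+ F)) h1 ?_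
    (v := ⟨v, hLE v hv⟩) hv ⟨t, hLE t htL⟩ htL
  · rintro h' ⟨h, hh, he⟩ h'1
    ext e
    have : h 1 = 1 := by
      have := he 1
      rw [h'1] at this
      exact this.symm
    rw [he]
    exact e.2 h hh this
  · rintro h' ⟨h, hh, he⟩ h'1 t htL
    have h11 : h 1 ∈ L := by
      have e1 := he 1
      change (h' 1 : F) ∈ L at h'1
      rw [e1] at h'1
      exact h'1
    change (h' t : F) ∈ L
    rw [he]
    exact hL h hh h11 t htL

/-- A transitive semilinear group in odd characteristic contains `-1`. -/
theorem exists_neg [Finite F] (hs : IsSemilinear H)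
    (ht : ∀ u : F, u ≠ 0 → ∃ h ∈ H, h 1 = u) (h2 : (2 : F) ≠ 0) :
    ∃ h ∈ H, ∀ t, h t = -t := by
  obtain ⟨p, _⟩ := CharP.exists F
  have hp : p.Prime := CharP.char_is_prime F p
  have : Fact p.Prime := ⟨hp⟩
  let _ := ZMod.algebra F p
  obtain ⟨π, hπ⟩ := hs.exists_hom p
  obtain ⟨ψ, hψ, hψ1⟩ := hs.exists_ker_hom hπ
  have hpodd : Odd p := hp.eq_two_or_odd'.resolve_left fun h => h2 (by
    have := CharP.cast_eq_zero F p
    rw [h] at this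
    exact_mod_cast this)
  have hdvd := hs.card_sub_one_dvd ht π
  rw [Module.natCard_eq_pow_finrank (K := ZMod p) (V := F), Nat.card_zmod] at hdvd
  have : Fact (Nat.Prime 2) := ⟨Nat.prime_two⟩
  obtain ⟨y, hy⟩ := exists_prime_orderOf_dvd_card' 2
    (two_dvd_of_dvd_mul hp.one_lt hpodd Module.finrank_pos.ne' hdvd).1
  rw [← orderOf_injective ψ hψ, ← orderOf_units, hψ1] at hy
  refine ⟨y.1.1, y.1.2, fun t => ?_⟩
  have hsq := pow_orderOf_eq_one (y.1.1 1)
  rw [hy, sq_eq_one_iff] at hsq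
  rcases hsq with h | h
  · rw [h, orderOf_one] at hy
    norm_num at hy
  · rw [scalar_apply hπ y.2, h, neg_one_mul]

end IsSemilinear
end SemilinearPerm

namespace SemilinearPerm

variable {F : Type*} [Field F]

/-- A block of imprimitivity containing `0` and `1` of the affine group generated by the
translations and a transitive semilinear group is a subfield. -/
theorem IsSemilinear.exists_subfield [Finite F] {H : Subgroup (Equiv.Perm F)}
    (hs : IsSemilinear H) (ht : ∀ u : F, u ≠ 0 → ∃ h ∈ H, h 1 = u) {L : Set F}
    (h0 : (0 : F) ∈ L) (h1 : (1 : F) ∈ L) (h3 : 2 < L.ncard)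
    (hL : ∀ h ∈ H, ∀ a ∈ L, ∀ b ∈ L, a ≠ b → ∀ d, h a + d ∈ L → h b + d ∈ L →
      ∀ t ∈ L, h t + d ∈ L) :
    ∃ K : Subfield F, ∀ c, c ∈ K ↔ c ∈ L := by
  have htr : ∀ a ∈ L, ∀ b ∈ L, a ≠ b → ∀ d, a + d ∈ L → b + d ∈ L → ∀ t ∈ L, t + d ∈ L :=
    hL 1 H.one_mem
  have hadd : ∀ a ∈ L, ∀ b ∈ L, a + b ∈ L := by
    intro a ha b hb
    by_cases h2 : (2 : F) = 0
    · rcases eq_or_ne b 0 with rfl | hb0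
      · rwa [add_zero]
      · refine htr 0 h0 b hb hb0.symm b (by rwa [zero_add]) ?_ a ha
        rwa [← two_mul, h2, zero_mul]
    · obtain ⟨ν, hν, hνt⟩ := hs.exists_neg ht h2
      have hsub : ∀ x ∈ L, x ≠ 0 → ∀ t ∈ L, x - t ∈ L := by
        intro x hx hx0 t htL
        have := hL ν hν x hx 0 h0 hx0 x (by rwa [hνt, neg_add_cancel])
          (by rwa [hνt, neg_zero, zero_add]) t htL
        rwa [hνt, neg_add_eq_sub] at this
      rcases eq_or_ne b 0 with rfl | hb0
      · rwa [add_zero]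
      obtain ⟨x, hx, hxn⟩ : ∃ x ∈ L, x ∉ ({0, b} : Set F) := by
        refine Set.exists_mem_notMem_of_ncard_lt_ncard ?_ (Set.toFinite _)
        rwa [Set.ncard_pair hb0.symm]
      simp only [Set.mem_insert_iff, Set.mem_singleton_iff, not_or] at hxn
      have := hsub x hx hxn.1 _
        (hsub _ (hsub x hx hxn.1 b hb) (sub_ne_zero.2 hxn.2) a ha)
      rwa [show x - (x - b - a) = a + b by ring] at this
  have hsmul : ∀ a ∈ L, ∀ m : ℕ, m • a ∈ L := by
    intro a ha m
    induction m with
    | zero => simpa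
    | succ m ih => rw [succ_nsmul]; exact hadd _ ih _ ha
  let A : AddSubgroup F :=
    { carrier := L
      add_mem' := fun ha hb => hadd _ ha _ hb
      zero_mem' := h0
      neg_mem' := fun {a} ha => by
        have : -a = (addOrderOf a - 1) • a := by
          rw [neg_eq_iff_add_eq_zero, ← succ_nsmul', Nat.sub_add_cancel (addOrderOf_pos a),
            addOrderOf_nsmul_eq_zero]
        rw [this]
        exact hsmul a ha _ }
  have hA : ∀ h ∈ H, h 1 ∈ A → ∀ t ∈ A, h t ∈ A := by
    intro h hh hh1 t htA
    have := hL h hh 0 h0 1 h1 zero_ne_one 0 (by rwa [add_zero, hs.map_zero hh])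
      (by rwa [add_zero]) t htA
    rwa [add_zero] at this
  refine ⟨multiplierSubfield A, fun c => ⟨fun hc => ?_, fun hc => ?_⟩⟩
  · have := mem_multiplierSubfield.1 hc 1 h1
    rwa [mul_one] at this
  · exact hs.mem_multiplierSubfield_of_mem ht (L := A) h1 hA hc

end SemilinearPerm

theorem RingEquiv.map_mem_subfield_iff {F : Type*} [Field F] [Finite F] (σ : F ≃+* F)
    (K : Subfield F) (c : F) : σ c ∈ K ↔ c ∈ K := by
  have hle : ∀ c ∈ K, σ c ∈ K := by
    intro c hc
    rcases eq_or_ne c 0 with rfl | hc0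
    · simp
    obtain ⟨m, hm⟩ := MonoidHom.map_cyclic (Units.map (σ : F →* F))
    have := congrArg Units.val (hm (Units.mk0 c hc0))
    rw [Units.coe_map, Units.val_zpow_eq_zpow_val, Units.val_mk0] at this
    change σ c = c ^ m at this
    rw [this]
    exact zpow_mem hc m
  refine ⟨fun h => ?_, hle c⟩
  have himg : σ '' (K : Set F) = K := by
    refine Set.eq_of_subset_of_ncard_le ?_ ?_ (Set.toFinite _)
    · rintro _ ⟨s, hs, rfl⟩
      exact hle s hs
    · rw [Set.ncard_image_of_injective _ σ.injective]
  have h' : σ c ∈ σ '' (K : Set F) := by rw [himg]; exact h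
  obtain ⟨s, hs, hst⟩ := h'
  rwa [← σ.injective hst]

theorem PLS.image_mem_lines_s13 {P : Type*} {G : Subgroup (Equiv.Perm P)} {S : PLS P}
    (hGS : G ≤ S.aut) {g : Equiv.Perm P} (hg : g ∈ G) {M : Set P} (hM : M ∈ S.lines) :
    g '' M ∈ S.lines := by
  have h : g • S.lines = S.lines := MulAction.mem_stabilizer_iff.1 (hGS hg)
  have := Set.smul_mem_smul_set (a := g) hM
  rw [h] at this
  exact this

section Affine

variable {V : Type*} [AddCommGroup V] {G : Subgroup (Equiv.Perm V)} {S : PLS V}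

theorem PLS.image_add_right_mem_lines (haff : IsAffinePermGroup G) (hGS : G ≤ S.aut)
    {M : Set V} (hM : M ∈ S.lines) (v : V) : (· + v) '' M ∈ S.lines :=
  S.image_mem_lines_s13 hGS (haff.1 v) hM

theorem zeroStabOrbit_symm {x y : V} (h : y ∈ zeroStabOrbit G x) : x ∈ zeroStabOrbit G y := by
  obtain ⟨g, hg, hg0, rfl⟩ := h
  exact ⟨g⁻¹, G.inv_mem hg, (Equiv.symm_apply_eq g).2 hg0.symm, g.symm_apply_apply x⟩

theorem zeroStabOrbit_trans {x y z : V} (hxy : y ∈ zeroStabOrbit G x)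
    (hyz : z ∈ zeroStabOrbit G y) : z ∈ zeroStabOrbit G x := by
  obtain ⟨g, hg, hg0, rfl⟩ := hxy
  obtain ⟨k, hk, hk0, rfl⟩ := hyz
  exact ⟨k * g, G.mul_mem hk hg, by rw [Equiv.Perm.mul_apply, hg0, hk0], rfl⟩

/-- Two nonzero vectors outside the orbit of a nonzero vector are in the same orbit. -/
theorem HasTwoZeroStabOrbits.mem_of_notMem (hrank : HasTwoZeroStabOrbits G) {w u v : V}
    (hw : w ≠ 0) (hu : u ≠ 0) (hv : v ≠ 0) (hwu : u ∉ zeroStabOrbit G w)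
    (hwv : v ∉ zeroStabOrbit G w) : v ∈ zeroStabOrbit G u := by
  obtain ⟨x, y, -, -, -, h⟩ := hrank
  have key : ∀ {a}, w ∈ zeroStabOrbit G a → ∀ {b}, b ∉ zeroStabOrbit G w →
      b ∉ zeroStabOrbit G a := fun ha _ hb hab =>
    hb (zeroStabOrbit_trans (zeroStabOrbit_symm ha) hab)
  rcases h w hw with hx | hy
  · exact zeroStabOrbit_trans (zeroStabOrbit_symm ((h u hu).resolve_left (key hx hwu)))
      ((h v hv).resolve_left (key hx hwv))
  · exact zeroStabOrbit_trans (zeroStabOrbit_symm ((h u hu).resolve_right (key hy hwu)))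
      ((h v hv).resolve_right (key hy hwv))

/-- If one orbit is closed under nonzero scalars then so is the other. -/
theorem HasTwoZeroStabOrbits.smul_mem_zeroStabOrbit {F : Type*} [Field F] [Module F V]
    (hrank : HasTwoZeroStabOrbits G)
    (hsemi : ∀ g ∈ G, g 0 = 0 →
      ∃ σ : F ≃+* F, ∀ (c : F) (v : V), g (c • v) = σ c • g v)
    {x : V} (hx0 : x ≠ 0)
    (hx : (Submodule.span F ({x} : Set V) : Set V) \ {0} ⊆ zeroStabOrbit G x)
    {u : V} (hu : u ≠ 0) {c : F} (hc : c ≠ 0) : c • u ∈ zeroStabOrbit G u := by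
  have hclosed : ∀ {u : V}, u ∈ zeroStabOrbit G x → ∀ {c : F}, c ≠ 0 →
      c • u ∈ zeroStabOrbit G x := by
    rintro _ ⟨g, hg, hg0, rfl⟩ c hc
    obtain ⟨σ, hσ⟩ := hsemi g hg hg0
    have hc' : σ.symm c ≠ 0 := by simpa using hc
    refine zeroStabOrbit_trans (hx ⟨?_, smul_ne_zero hc' hx0⟩) ⟨g, hg, hg0, ?_⟩
    · exact Submodule.smul_mem _ _ (Submodule.mem_span_singleton_self x)
    · rw [hσ, RingEquiv.apply_symm_apply]
  by_cases hux : u ∈ zeroStabOrbit G x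
  · exact zeroStabOrbit_trans (zeroStabOrbit_symm hux) (hclosed hux hc)
  · refine hrank.mem_of_notMem hx0 hu (smul_ne_zero hc hu) hux fun h => hux ?_
    have := hclosed h (inv_ne_zero hc)
    rwa [inv_smul_smul₀ hc] at this

theorem PLS.apply_mem_nbrs (hGS : G ≤ S.aut) {g : Equiv.Perm V} (hg : g ∈ G) (hg0 : g 0 = 0)
    {u : V} (hu : u ∈ S.nbrs 0) : g u ∈ S.nbrs 0 := by
  obtain ⟨hne, M, hM, h0, huM⟩ := hu
  refine ⟨?_, g '' M, S.image_mem_lines_s13 hGS hg hM, ⟨0, h0, hg0⟩, ⟨u, huM, rfl⟩⟩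
  rw [← hg0]
  exact g.injective.ne hne

/-- In a rank 3 affine partial linear space that is not a linear space, the neighbours of `0`
form a single orbit. -/
theorem PLS.nbrs_zero_eq (haff : IsAffinePermGroup G) (hrank : HasTwoZeroStabOrbits G)
    (hGS : G ≤ S.aut) (hlin : ¬ S.IsLinearSpace) {w : V} (hw : w ∈ S.nbrs 0) :
    S.nbrs 0 = zeroStabOrbit G w := by
  have hle : ∀ {u}, u ∈ S.nbrs 0 → zeroStabOrbit G u ⊆ S.nbrs 0 := by
    rintro u hu _ ⟨g, hg, hg0, rfl⟩
    exact S.apply_mem_nbrs hGS hg hg0 hu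
  refine Set.Subset.antisymm (fun u hu => ?_) (hle hw)
  by_contra hwu
  refine hlin fun x y hxy => ?_
  have hz : y - x ≠ 0 := sub_ne_zero.2 hxy.symm
  have hmem : y - x ∈ S.nbrs 0 := by
    by_cases h : y - x ∈ zeroStabOrbit G w
    · exact hle hw h
    · exact hle hu (hrank.mem_of_notMem hw.1.symm hu.1.symm hz hwu h)
  obtain ⟨-, M, hM, h0, hyx⟩ := hmem
  refine ⟨(· + x) '' M, ⟨S.image_add_right_mem_lines haff hGS hM x, ⟨0, h0, zero_add x⟩,
    ⟨_, hyx, sub_add_cancel y x⟩⟩, ?_⟩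
  rintro M' ⟨hM', hx', hy'⟩
  exact S.unique_of_pair _ hM' _ (S.image_add_right_mem_lines haff hGS hM x) x y hxy hx' hy'
    ⟨0, h0, zero_add x⟩ ⟨_, hyx, sub_add_cancel y x⟩

/-- A partial linear space that is not a graph and has a transitive automorphism group has a
line through `0` with more than two points. -/
theorem PLS.exists_line_zero_mem (haff : IsAffinePermGroup G) (hGS : G ≤ S.aut)
    (hgraph : ¬ S.IsGraph) : ∃ M ∈ S.lines, (0 : V) ∈ M ∧ 2 < M.ncard := by
  simp only [PLS.IsGraph, not_forall] at hgraph
  obtain ⟨M, hM, hne⟩ := hgraph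
  have h2 := S.two_le_ncard M hM
  obtain ⟨v, hv⟩ : M.Nonempty := Set.nonempty_of_ncard_ne_zero (by omega)
  refine ⟨(· + -v) '' M, S.image_add_right_mem_lines haff hGS hM (-v),
    ⟨v, hv, add_neg_cancel v⟩, ?_⟩
  rw [Set.ncard_image_of_injective _ (add_left_injective (-v))]
  omega

/-- The permutations of `F` induced on the line `⟨w⟩` by the elements of `G` fixing `0` and
that line. -/
def spanPerm (F : Type*) [Field F] [Module F V] (G : Subgroup (Equiv.Perm V)) (w : V) :
    Subgroup (Equiv.Perm F) where
  carrier := {h | ∃ g ∈ G, g 0 = 0 ∧ ∀ c : F, g (c • w) = h c • w}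
  mul_mem' := by
    rintro a b ⟨a', ha', ha0, ha⟩ ⟨b', hb', hb0, hb⟩
    refine ⟨a' * b', G.mul_mem ha' hb', ?_, fun c => ?_⟩
    · rw [Equiv.Perm.mul_apply, hb0, ha0]
    · rw [Equiv.Perm.mul_apply, hb, ha, Equiv.Perm.mul_apply]
  one_mem' := ⟨1, G.one_mem, rfl, fun _ => rfl⟩
  inv_mem' := by
    rintro a ⟨a', ha', ha0, ha⟩
    refine ⟨a'⁻¹, G.inv_mem ha', (Equiv.symm_apply_eq a').2 ha0.symm, fun c => ?_⟩
    refine (Equiv.symm_apply_eq a').2 ?_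
    rw [ha]
    exact congrArg (· • w) (a.apply_symm_apply c).symm

theorem isSemilinear_spanPerm {F : Type*} [Field F] [Module F V] {w : V} (hw : w ≠ 0)
    (hsemi : ∀ g ∈ G, g 0 = 0 →
      ∃ σ : F ≃+* F, ∀ (c : F) (v : V), g (c • v) = σ c • g v) :
    SemilinearPerm.IsSemilinear (spanPerm F G w) := by
  rintro h ⟨g, hg, hg0, hgw⟩
  obtain ⟨σ, hσ⟩ := hsemi g hg hg0
  refine ⟨σ, fun t => smul_left_injective F hw ?_⟩
  have h1 := hgw 1
  rw [one_smul] at h1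
  change h t • w = (h 1 * σ t) • w
  rw [← hgw, hσ, h1, smul_smul, mul_comm]

theorem exists_mem_spanPerm {F : Type*} [Field F] [Module F V] {w : V}
    (hsemi : ∀ g ∈ G, g 0 = 0 →
      ∃ σ : F ≃+* F, ∀ (c : F) (v : V), g (c • v) = σ c • g v)
    {u : F} (hu : u ≠ 0) (huw : u • w ∈ zeroStabOrbit G w) :
    ∃ h ∈ spanPerm F G w, h 1 = u := by
  obtain ⟨g, hg, hg0, hgw⟩ := huw
  obtain ⟨σ, hσ⟩ := hsemi g hg hg0
  refine ⟨σ.toEquiv.trans (Equiv.mulRight₀ u hu), ⟨g, hg, hg0, fun c => ?_⟩, ?_⟩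
  · rw [hσ, hgw, smul_smul]
    rfl
  · change σ 1 * u = u
    rw [map_one, one_mul]

theorem PLS.mem_of_spanPerm (haff : IsAffinePermGroup G) (hGS : G ≤ S.aut)
    {F : Type*} [Field F] [Module F V] {w : V} (hw : w ≠ 0) {M : Set V} (hM : M ∈ S.lines)
    {h : Equiv.Perm F} (hh : h ∈ spanPerm F G w) {a b d : F} (ha : a • w ∈ M) (hb : b • w ∈ M)
    (hab : a ≠ b) (had : (h a + d) • w ∈ M) (hbd : (h b + d) • w ∈ M) {t : F}
    (ht : t • w ∈ M) : (h t + d) • w ∈ M := by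
  obtain ⟨g, hg, -, hgw⟩ := hh
  have hτ : ∀ c, c • w ∈ M → (h c + d) • w ∈ (· + d • w) '' (g '' M) := fun c hc =>
    ⟨g (c • w), ⟨_, hc, rfl⟩, by rw [hgw, add_smul]⟩
  have hne : (h a + d) • w ≠ (h b + d) • w := fun e =>
    hab (h.injective (add_right_cancel (smul_left_injective F hw e)))
  rw [S.unique_of_pair M hM _ (S.image_add_right_mem_lines haff hGS
    (S.image_mem_lines_s13 hGS hg hM) (d • w)) _ _ hne had hbd (hτ a ha) (hτ b hb)]
  exact hτ t ht

end Affine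

/-- **Proposition 4.2.** Let `G` be an affine permutation group of rank 3 on `V = V_n(q)`
(`n ≥ 2`) with `G₀ ≤ ΓL_n(q)` such that the punctured `F_q`-span of some nonzero `x` is
contained in `x^{G₀}`.  Every `F_q`-dependent `G`-affine proper partial linear space has
line set `{⟨u⟩_F + v : u ∈ X, v ∈ V}` for some subfield `F` with `|F| > 2` and some orbit
`X` of `G₀` on the nonzero vectors. -/
theorem dependent_classification
    {n : ℕ} (hn : 2 ≤ n)
    (F : Type*) [Field F] [Fintype F]
    (V : Type*) [AddCommGroup V] [Module F V] [Finite V]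
    (hdim : Module.finrank F V = n)
    (G : Subgroup (Equiv.Perm V))
    (haff : IsAffinePermGroup G) (hrank : HasTwoZeroStabOrbits G)
    (hsemi : ∀ g ∈ G, g 0 = 0 →
      ∃ σ : F ≃+* F, ∀ (c : F) (v : V), g (c • v) = σ c • g v)
    (hx : ∃ x : V, x ≠ 0 ∧
      (Submodule.span F ({x} : Set V) : Set V) \ {0} ⊆ zeroStabOrbit G x)
    (S : PLS V) (hproper : S.IsProper) (hGS : G ≤ S.aut)
    (hdep : ∀ L ∈ S.lines, (0 : V) ∈ L → ∀ y ∈ L, y ≠ 0 →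
      L ⊆ (Submodule.span F ({y} : Set V) : Set V)) :
    ∃ K : Subfield F, 2 < Nat.card K ∧ ∃ w : V, w ≠ 0 ∧
      S.lines = {M : Set V | ∃ u ∈ zeroStabOrbit G w, ∃ v : V,
        M = {z : V | ∃ c ∈ K, z = c • u + v}} := by
  obtain ⟨x, hx0, hx⟩ := hx
  obtain ⟨ℓ, hℓ, h0, h3⟩ := S.exists_line_zero_mem haff hGS hproper.2
  obtain ⟨w, hwℓ, hw⟩ := Set.exists_ne_of_one_lt_ncard (one_lt_two.trans h3) 0
  have hspan : ∀ z ∈ ℓ, ∃ c : F, c • w = z := fun z hz =>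
    Submodule.mem_span_singleton.1 (hdep ℓ hℓ h0 w hwℓ hw hz)
  have hnbrs := S.nbrs_zero_eq haff hrank hGS hproper.1 (w := w) ⟨hw.symm, ℓ, hℓ, h0, hwℓ⟩
  obtain ⟨K, hK⟩ := (isSemilinear_spanPerm hw hsemi).exists_subfield
    (fun u hu => exists_mem_spanPerm hsemi hu
      (hrank.smul_mem_zeroStabOrbit hsemi hx0 hx hw hu))
    (L := {c : F | c • w ∈ ℓ})
    (by simpa using h0) (by simpa using hwℓ)
    (by
      rwa [← Set.ncard_image_of_injective _ (smul_left_injective F hw),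
        show (fun c : F => c • w) '' {c : F | c • w ∈ ℓ} = ℓ from
          Set.image_preimage_eq_of_subset hspan])
    fun h hh a ha b hb hab d had hbd t ht =>
      S.mem_of_spanPerm haff hGS hw hℓ hh ha hb hab had hbd ht
  have hℓK : ∀ g ∈ G, g 0 = 0 → g '' ℓ = {z : V | ∃ c ∈ K, z = c • g w} := by
    intro g hg hg0
    obtain ⟨σ, hσ⟩ := hsemi g hg hg0
    ext z
    constructor
    · rintro ⟨y, hy, rfl⟩
      obtain ⟨c, rfl⟩ := hspan y hy
      exact ⟨σ c, (σ.map_mem_subfield_iff K c).2 ((hK c).2 hy), hσ c w⟩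
    · rintro ⟨c, hc, rfl⟩
      obtain ⟨c, rfl⟩ := σ.surjective c
      exact ⟨c • w, (hK c).1 ((σ.map_mem_subfield_iff K c).1 hc), hσ c w⟩
  have hadd : ∀ (u v : V), (· + v) '' {z : V | ∃ c ∈ K, z = c • u} =
      {z : V | ∃ c ∈ K, z = c • u + v} := by
    intro u v
    ext z
    constructor
    · rintro ⟨_, ⟨c, hc, rfl⟩, rfl⟩
      exact ⟨c, hc, rfl⟩
    · rintro ⟨c, hc, rfl⟩
      exact ⟨c • u, ⟨c, hc, rfl⟩, rfl⟩
  refine ⟨K, ?_, w, hw, Set.Subset.antisymm ?_ ?_⟩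
  · have hKℓ : (fun c : F => c • w) '' (K : Set F) = ℓ := by
      ext z
      constructor
      · rintro ⟨c, hc, rfl⟩
        exact (hK c).1 hc
      · intro hz
        obtain ⟨c, rfl⟩ := hspan z hz
        exact ⟨c, (hK c).2 hz, rfl⟩
    rw [← hKℓ, Set.ncard_image_of_injective _ (smul_left_injective F hw)] at h3
    exact h3
  · intro M hM
    obtain ⟨a, ha, b, hb, hab⟩ := (Set.one_lt_ncard (Set.toFinite M)).1 (S.two_le_ncard M hM)
    have hM' := S.image_add_right_mem_lines haff hGS hM (-a)
    have h0M : (0 : V) ∈ (· + -a) '' M := ⟨a, ha, add_neg_cancel a⟩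
    have hbM : b + -a ∈ (· + -a) '' M := ⟨b, hb, rfl⟩
    have hne : (0 : V) ≠ b + -a := fun h => hab (add_neg_eq_zero.1 h.symm).symm
    have hmem : b + -a ∈ S.nbrs 0 := ⟨hne, _, hM', h0M, hbM⟩
    rw [hnbrs] at hmem
    refine ⟨b + -a, hmem, a, ?_⟩
    obtain ⟨g, hg, hg0, hgw⟩ := hmem
    rw [← hadd, ← hgw, ← hℓK g hg hg0, S.unique_of_pair _ (S.image_mem_lines_s13 hGS hg hℓ) _ hM' _ _
      hne ⟨0, h0, hg0⟩ ⟨w, hwℓ, hgw⟩ h0M hbM, Set.image_image]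
    simp
  · rintro _ ⟨_, ⟨g, hg, hg0, rfl⟩, v, rfl⟩
    rw [← hadd, ← hℓK g hg hg0]
    exact S.image_add_right_mem_lines haff hGS (S.image_mem_lines_s13 hGS hg hℓ) v
end
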